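/- arXiv:1512.07655 — 2 statements merged into one kernel-verified Lean document; each statement's English description precedes it below -/
import Mathlib

section
/- Let ε₀, γ₀ > 0 be constants with c₀ ≥ ε₀, and let n be sufficiently large. Let G* be an n-vertex graph whose vertex degrees are all between c₀n - n^{2/3} and c₀n + n^{2/3}, such that there are at least γ₀n² edges between any two vertex subsets A, B satisfying |A| ≥ c₀n/3 and |B| ≥ n/2. Then G* has a regular spanning subgraph of degree 2d, where d = ⌈(c₀ - ε₀)n/2⌉. -/
open SimpleGraph

/-- The degree of a vertex, defined via `Set.ncard` (no decidability assumptions). -/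
noncomputable def degN {V : Type*} (G : SimpleGraph V) (v : V) : ℕ :=
  (G.neighborSet v).ncard

/-- `G` is `d`-regular. -/
def IsRegN {V : Type*} (G : SimpleGraph V) (d : ℕ) : Prop :=
  ∀ v, degN G v = d

/-- `H` (a spanning subgraph, viewed as a graph on the full vertex set) is a
Hamilton cycle: it is connected and 2-regular. -/
def IsHamCycleGraph {V : Type*} (H : SimpleGraph V) : Prop :=
  H.Connected ∧ IsRegN H 2

/-- `D` is a Hamiltonian decomposition of `Γ`: a family of pairwise edge-disjoint
Hamilton cycles whose union is `Γ`. -/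
def IsHamDecomp {V : Type*} (Γ : SimpleGraph V) (D : Finset (SimpleGraph V)) : Prop :=
  (∀ H ∈ D, IsHamCycleGraph H) ∧
  (D : Set (SimpleGraph V)).Pairwise Disjoint ∧
  D.sup id = Γ

/-- The number of Hamiltonian decompositions of `Γ`. -/
noncomputable def numHamDecomp {V : Type*} (Γ : SimpleGraph V) : ℕ :=
  {D : Finset (SimpleGraph V) | IsHamDecomp Γ D}.ncard

/-- The number of edges of `G` with one endpoint in `A` and the other endpoint in `B`
(edges with both endpoints in `A ∩ B` are counted once). -/
noncomputable def eBetween {V : Type*} (G : SimpleGraph V) (A B : Set V) : ℕ :=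
  {e ∈ G.edgeSet | ∃ a ∈ A, ∃ b ∈ B, e = s(a, b)}.ncard


namespace RegSub

open Finset Classical

variable {V : Type*} [Fintype V]

/-- Degree as a finset cardinality. -/
noncomputable def dg (H : SimpleGraph V) (u : V) : ℕ := (univ.filter (fun b => H.Adj u b)).card

lemma dg_eq_degN (H : SimpleGraph V) (u : V) : degN H u = dg H u := by
  unfold degN dg
  rw [← Set.ncard_coe_finset]
  congr 1
  ext b
  simp

lemma dg_eq_degree (H : SimpleGraph V) (u : V) : dg H u = H.degree u := by
  unfold dg
  rw [← SimpleGraph.card_neighborFinset_eq_degree]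
  congr 1
  ext b
  simp

lemma dg_add (H : SimpleGraph V) {p q : V} (hpq : p ≠ q) (h : ¬ H.Adj p q) (u : V) :
    dg (H ⊔ SimpleGraph.edge p q) u
      = dg H u + (if u = p then 1 else 0) + (if u = q then 1 else 0) := by
  have h' : ¬ H.Adj q p := fun hh => h hh.symm
  unfold dg
  by_cases h1 : u = p
  · subst h1
    trans (insert q (univ.filter (fun b => H.Adj u b))).card
    · congr 1
      ext b
      simp only [mem_filter, mem_univ, true_and, mem_insert, SimpleGraph.sup_adj,
        SimpleGraph.edge_adj]
      grind
    · rw [card_insert_of_notMem (by simpa using h)]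
      simp [hpq]
  · by_cases h2 : u = q
    · subst h2
      trans (insert p (univ.filter (fun b => H.Adj u b))).card
      · congr 1
        ext b
        simp only [mem_filter, mem_univ, true_and, mem_insert, SimpleGraph.sup_adj,
          SimpleGraph.edge_adj]
        grind
      · rw [card_insert_of_notMem (by simpa using h')]
        simp [h1]
    · trans (univ.filter (fun b => H.Adj u b)).card
      · congr 1
        ext b
        simp only [mem_filter, mem_univ, true_and, SimpleGraph.sup_adj,
          SimpleGraph.edge_adj]
        grind
      · simp [h1, h2]

lemma dg_del (H : SimpleGraph V) {p q : V} (h : H.Adj p q) (u : V) :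
    dg H u = dg (H \ SimpleGraph.edge p q) u
      + (if u = p then 1 else 0) + (if u = q then 1 else 0) := by
  have hpq : p ≠ q := h.ne
  rw [← dg_add (H \ SimpleGraph.edge p q) hpq]
  · congr 1
    ext a b
    simp only [SimpleGraph.sup_adj, SimpleGraph.sdiff_adj, SimpleGraph.edge_adj]
    have := h.symm
    constructor
    · grind
    · rintro (h1 | ⟨⟨rfl, rfl⟩ | ⟨rfl, rfl⟩, h2⟩)
      · exact h1.1
      · exact h
      · exact this
  · simp [SimpleGraph.edge_adj, hpq]

/-- Even-reachable vertices from the odd-reachable set `X`. -/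
noncomputable def Yset (H : SimpleGraph V) (m : ℕ) (X : Finset V) : Finset V :=
  univ.filter (fun y => m ≤ (univ.filter (fun z => H.Adj y z ∧ z ∈ X)).card)

/-- Robustly odd-reachable vertices. -/
noncomputable def Xset (G H : SimpleGraph V) (v : V) (m : ℕ) : ℕ → Finset V
  | 0 => univ.filter (fun x => G.Adj v x ∧ ¬ H.Adj v x)
  | i + 1 => Xset G H v m i ∪ univ.filter (fun x =>
      m ≤ (univ.filter (fun y => (G.Adj x y ∧ ¬ H.Adj x y)
        ∧ y ∈ Yset H m (Xset G H v m i))).card)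

lemma Xset_mono (G H : SimpleGraph V) (v : V) (m : ℕ) : Monotone (Xset G H v m) :=
  monotone_nat_of_le_succ (fun i => by rw [Xset]; exact subset_union_left)

lemma reach (G H : SimpleGraph V) (hHG : H ≤ G) (v : V) (m : ℕ) :
    ∀ (i : ℕ) (x : V), x ∈ Xset G H v m i → ∀ F : Finset V, v ∉ F → x ∉ F →
      F.card + i + 1 < m → ∃ H' : SimpleGraph V, H' ≤ G ∧
        (∀ u, dg H' u = dg H u + (if u = v then 1 else 0) + (if u = x then 1 else 0)) ∧
        ∀ a ∈ F, ∀ b, H'.Adj a b ↔ H.Adj a b := by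
  intro i
  induction i with
  | zero =>
    intro x hx F hv hxF _
    simp only [Xset, mem_filter, mem_univ, true_and] at hx
    refine ⟨H ⊔ SimpleGraph.edge v x, ?_, ?_, ?_⟩
    · refine sup_le hHG ?_
      intro a b hab
      rw [SimpleGraph.edge_adj] at hab
      rcases hab with ⟨⟨rfl, rfl⟩ | ⟨rfl, rfl⟩, _⟩
      · exact hx.1
      · exact hx.1.symm
    · exact fun u => dg_add H hx.1.ne hx.2 u
    · intro a ha b
      simp only [SimpleGraph.sup_adj, SimpleGraph.edge_adj]
      grind
  | succ i ih =>
    intro x hx F hv hxF hm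
    rw [Xset, mem_union] at hx
    rcases hx with hx | hx
    · exact ih x hx F hv hxF (by omega)
    simp only [mem_filter, mem_univ, true_and] at hx
    have h1 : ∃ y ∈ (univ.filter (fun y => (G.Adj x y ∧ ¬ H.Adj x y)
        ∧ y ∈ Yset H m (Xset G H v m i))), y ∉ insert v F := by
      apply exists_mem_notMem_of_card_lt_card
      have := card_insert_le v F
      omega
    obtain ⟨y, hy, hyF⟩ := h1
    simp only [mem_filter, mem_univ, true_and, Yset] at hy
    obtain ⟨⟨hGy, hHy⟩, hyY⟩ := hy
    have h2 : ∃ z ∈ (univ.filter (fun z => H.Adj y z ∧ z ∈ Xset G H v m i)), z ∉ F := by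
      apply exists_mem_notMem_of_card_lt_card
      omega
    obtain ⟨z, hz, hzF⟩ := h2
    simp only [mem_filter, mem_univ, true_and] at hz
    obtain ⟨hyz, hzX⟩ := hz
    have hyv : y ≠ v := by grind
    have hyF' : y ∉ F := by grind
    obtain ⟨H2, hH2, hd2, hF2⟩ := ih z hzX (insert y F)
      (by simp only [mem_insert, not_or]; exact ⟨hyv.symm, hv⟩)
      (by simp only [mem_insert, not_or]; exact ⟨hyz.ne', hzF⟩)
      (by have := card_insert_le y F; omega)
    have ayz : H2.Adj y z := (hF2 y (mem_insert_self _ _) z).2 hyz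
    have ayx : ¬ H2.Adj y x := fun h => hHy ((hF2 y (mem_insert_self _ _) x).1 h).symm
    have hxy : y ≠ x := hGy.ne'
    refine ⟨(H2 \ SimpleGraph.edge y z) ⊔ SimpleGraph.edge y x, ?_, ?_, ?_⟩
    · refine sup_le (sdiff_le.trans hH2) ?_
      intro a b hab
      rw [SimpleGraph.edge_adj] at hab
      rcases hab with ⟨⟨rfl, rfl⟩ | ⟨rfl, rfl⟩, _⟩
      · exact hGy.symm
      · exact hGy
    · intro u
      have e1 := dg_add (H2 \ SimpleGraph.edge y z) hxy (fun h => ayx h.1) u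
      have e2 := dg_del H2 ayz u
      have e3 := hd2 u
      omega
    · intro a ha b
      rw [← hF2 a (mem_insert_of_mem ha) b]
      simp only [SimpleGraph.sup_adj, SimpleGraph.sdiff_adj, SimpleGraph.edge_adj]
      have : a ≠ y := by rintro rfl; exact hyF' ha
      have : a ≠ z := by rintro rfl; exact hzF ha
      have : a ≠ x := by rintro rfl; exact hxF ha
      grind

lemma exists_extremal (G : SimpleGraph V) (D : ℕ) :
    ∃ H : SimpleGraph V, H ≤ G ∧ (∀ u, dg H u ≤ D) ∧
      ∀ H' : SimpleGraph V, H' ≤ G → (∀ u, dg H' u ≤ D) → ∑ u, dg H' u ≤ ∑ u, dg H u := by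
  obtain ⟨H, ⟨h1, h2⟩, h3⟩ := Set.exists_max_image
    {H : SimpleGraph V | H ≤ G ∧ ∀ u, dg H u ≤ D} (fun H => ∑ u, dg H u) (Set.toFinite _)
    ⟨⊥, bot_le, fun u => by simp [dg]⟩
  exact ⟨H, h1, h2, fun H' a b => h3 H' ⟨a, b⟩⟩

lemma even_sum_dg (H : SimpleGraph V) : Even (∑ u, dg H u) := by
  simp only [dg_eq_degree]
  rw [SimpleGraph.sum_degrees_eq_twice_card_edges]
  exact even_two_mul _

/-- Structural outcome: either a regular subgraph, or a robust obstruction. -/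
lemma obstruction_exists (G : SimpleGraph V) (d m N : ℕ) (hN : Fintype.card V < N * m)
    (hm : N + 1 < m) (hreg : ¬ ∃ H ≤ G, ∀ u, dg H u = 2 * d) :
    ∃ (H : SimpleGraph V) (X Y Xp : Finset V) (v w : V), H ≤ G ∧ (∀ u, dg H u ≤ 2 * d) ∧
      (∀ x, G.Adj v x → ¬ H.Adj v x → x ∈ X) ∧
      X ⊆ Xp ∧ Xp.card ≤ X.card + m ∧ w ∉ Xp ∧
      (∀ x ∈ X, 2 * d ≤ dg H x + 1) ∧
      (∀ y, y ∉ Y → (univ.filter (fun z => H.Adj y z ∧ z ∈ X)).card ≤ m) ∧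
      (∀ x, x ∉ Xp → (univ.filter (fun y => (G.Adj x y ∧ ¬ H.Adj x y) ∧ y ∈ Y)).card ≤ m) := by
  obtain ⟨H, hHG, hHd, hmax⟩ := exists_extremal G (2 * d)
  have hv : ∃ v, dg H v < 2 * d := by
    by_contra hcon
    push Not at hcon
    exact hreg ⟨H, hHG, fun u => le_antisymm (hHd u) (hcon u)⟩
  obtain ⟨v, hv⟩ := hv
  -- the forbidden targets
  have htarget : ∀ i, i ≤ N → ∀ x ∈ Xset G H v m i,
      ¬ ((x ≠ v ∧ dg H x < 2 * d) ∨ dg H x + 2 ≤ 2 * d) := by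
    intro i hi x hx hbad
    obtain ⟨H', h1, h2, -⟩ := reach G H hHG v m i x hx ∅ (by simp) (by simp) (by simp; omega)
    have hle := hmax H' h1 (fun u => by
      rw [h2 u]
      have := hHd u
      split_ifs <;> grind)
    have hlt : ∑ u, dg H u < ∑ u, dg H' u := by
      apply sum_lt_sum
      · intro u _
        rw [h2 u]; omega
      · exact ⟨v, mem_univ _, by rw [h2 v]; simp; omega⟩
    omega
  have hw : ∃ w, (w ≠ v ∧ dg H w < 2 * d) ∨ dg H w + 2 ≤ 2 * d := by
    by_contra hcon
    push Not at hcon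
    have hv1 : dg H v + 1 = 2 * d := by have := (hcon v).2; omega
    have hs : ∑ u, dg H u + 1 = Fintype.card V * (2 * d) := by
      have e1 : ∑ u, (dg H u + if u = v then 1 else 0) = ∑ u : V, 2 * d := by
        apply sum_congr rfl
        intro u _
        by_cases huv : u = v
        · subst huv; simpa using hv1
        · have := (hcon u).1 huv
          have := hHd u
          simp [huv]; omega
      rw [sum_add_distrib] at e1
      simpa using e1
    obtain ⟨k, hk⟩ := even_sum_dg H
    have : Fintype.card V * (2 * d) = 2 * (Fintype.card V * d) := by ring
    omega
  obtain ⟨w, hw⟩ := hw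
  have hpig : ∃ i, i < N ∧ (Xset G H v m (i + 1)).card ≤ (Xset G H v m i).card + m := by
    by_contra hcon
    push Not at hcon
    have : ∀ i, i ≤ N → i * m ≤ (Xset G H v m i).card := by
      intro i
      induction i with
      | zero => simp
      | succ i ih =>
        intro hi
        have h1 := ih (by omega)
        have h2 := hcon i (by omega)
        rw [add_mul]; omega
    have h1 := this N le_rfl
    have h2 := card_le_univ (Xset G H v m N)
    omega
  obtain ⟨i, hi, hcard⟩ := hpig
  refine ⟨H, Xset G H v m i, Yset H m (Xset G H v m i), Xset G H v m (i + 1), v, w, hHG, hHd,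
    ?_, Xset_mono G H v m (Nat.le_succ i), hcard, ?_, ?_, ?_, ?_⟩
  · intro x hx hx'
    apply Xset_mono G H v m (Nat.zero_le i)
    simp [Xset, hx, hx']
  · intro hmem
    exact htarget (i + 1) hi w hmem hw
  · intro x hx
    have := htarget i hi.le x hx
    push Not at this
    omega
  · intro y hy
    simp only [Yset, mem_filter, mem_univ, true_and] at hy
    omega
  · intro x hx
    rw [Xset] at hx
    simp only [mem_union, mem_filter, mem_univ, true_and] at hx
    omega

end RegSub

namespace RegSub

open Finset Classical

variable {V : Type*} [Fintype V]

lemma counting (g h : V → V → ℝ) (gs : ∀ a b, g a b = g b a) (hs : ∀ a b, h a b = h b a)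
    (h0 : ∀ a b, 0 ≤ h a b) (hg : ∀ a b, h a b ≤ g a b) (g1 : ∀ a b, g a b ≤ 1)
    (X Y Xp : Finset V) (v w : V) (n D m s c : ℝ) (hn : n = Fintype.card V)
    (hs0 : 0 ≤ s) (hm0 : 0 ≤ m)
    (hd : ∀ u, ∑ b, h u b ≤ D) (hx : ∀ x ∈ X, D - 1 ≤ ∑ b, h x b)
    (hv : ∀ x, x ∉ X → g v x = h v x) (hXp : X ⊆ Xp) (hXpc : (Xp.card : ℝ) ≤ X.card + m)
    (hw : w ∉ Xp) (hY : ∀ y, y ∉ Y → ∑ z ∈ X, h y z ≤ m)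
    (hX' : ∀ x, x ∉ Xp → ∑ y ∈ Y, (g x y - h x y) ≤ m)
    (hlo : ∀ u, c - s ≤ ∑ b, g u b) (hhi : ∀ u, ∑ b, g u b ≤ c + s) :
    (∑ x ∈ Xᶜ, ∑ y ∈ Y, g x y ≤ D * (Y.card - X.card) + n + 3 * m * n) ∧
    (c * (Y.card - X.card) - 2 * s * n ≤ ∑ x ∈ Xᶜ, ∑ y ∈ Y, g x y) ∧
    (0 ≤ ∑ x ∈ Xᶜ, ∑ y ∈ Y, g x y) ∧
    (c - s - D ≤ X.card) ∧
    ((c - s) * Y.card ≤ X.card * Y.card + ∑ x ∈ Xᶜ, ∑ y ∈ Y, g x y) ∧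
    (c - s - D - m ≤ n - Y.card) ∧
    ((c - s) * (n - X.card) ≤ ∑ x ∈ Xᶜ, ∑ y ∈ Y, g x y + (n - X.card) * (n - Y.card)) ∧
    c - s ≤ n ∧ (X.card : ℝ) ≤ n ∧ (Y.card : ℝ) ≤ n := by
  have g0 : ∀ a b, 0 ≤ g a b := fun a b => (h0 a b).trans (hg a b)
  have cX : ((Xᶜ).card : ℝ) = n - X.card := by
    rw [card_compl, Nat.cast_sub (card_le_univ X), hn]
  have cY : ((Yᶜ).card : ℝ) = n - Y.card := by
    rw [card_compl, Nat.cast_sub (card_le_univ Y), hn]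
  have Xn : (X.card : ℝ) ≤ n := by rw [hn]; exact_mod_cast card_le_univ X
  have Yn : (Y.card : ℝ) ≤ n := by rw [hn]; exact_mod_cast card_le_univ Y
  have X0 : (0 : ℝ) ≤ X.card := Nat.cast_nonneg _
  have Y0 : (0 : ℝ) ≤ Y.card := Nat.cast_nonneg _
  have sp : ∀ (S : Finset V) (f : V → ℝ), ∑ b, f b = ∑ b ∈ S, f b + ∑ b ∈ Sᶜ, f b :=
    fun S f => (sum_add_sum_compl S f).symm
  have bd : ∀ (S : Finset V) (f : V → ℝ) (k : ℝ), (∀ x ∈ S, f x ≤ k) →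
      ∑ x ∈ S, f x ≤ S.card * k := fun S f k hf => by
    simpa using sum_le_card_nsmul S f k hf
  have bd' : ∀ (S : Finset V) (f : V → ℝ) (k : ℝ), (∀ x ∈ S, k ≤ f x) →
      S.card * k ≤ ∑ x ∈ S, f x := fun S f k hf => by
    simpa using card_nsmul_le_sum S f k hf
  -- H-edges
  have a1 : X.card * (D - 1) ≤ ∑ x ∈ X, ∑ b, h x b := bd' _ _ _ hx
  have a2 : ∑ x ∈ X, ∑ b, h x b = ∑ x ∈ X, ∑ y ∈ Y, h x y + ∑ x ∈ X, ∑ y ∈ Yᶜ, h x y := by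
    rw [← sum_add_distrib]; exact sum_congr rfl (fun x _ => sp Y _)
  have a3 : ∑ x ∈ X, ∑ y ∈ Yᶜ, h x y ≤ (n - Y.card) * m := by
    rw [sum_comm, ← cY]
    apply bd
    intro y hy
    rw [sum_congr rfl (fun x _ => hs x y)]
    exact hY y (by simpa using hy)
  have a4 : ∑ y ∈ Y, ∑ x, h y x ≤ Y.card * D := bd _ _ _ (fun y _ => hd y)
  have a5 : ∑ y ∈ Y, ∑ x, h y x = ∑ x ∈ X, ∑ y ∈ Y, h x y + ∑ x ∈ Xᶜ, ∑ y ∈ Y, h x y := by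
    rw [sum_comm, sp X]
    congr 1 <;> exact sum_congr rfl (fun x _ => sum_congr rfl (fun y _ => hs _ _))
  -- non-H edges
  have a6 : ∑ x ∈ Xᶜ, ∑ y ∈ Y, (g x y - h x y) ≤ 2 * m * n := by
    have e : ∑ x ∈ Xᶜ, ∑ y ∈ Y, (g x y - h x y) = ∑ x ∈ Xp \ X, ∑ y ∈ Y, (g x y - h x y)
        + ∑ x ∈ Xpᶜ, ∑ y ∈ Y, (g x y - h x y) := by
      rw [← sum_union]
      · congr 1
        ext x
        have := @hXp x
        simp only [mem_compl, mem_union, mem_sdiff]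
        tauto
      · rw [Finset.disjoint_left]
        intro x
        simp only [mem_compl, mem_sdiff]
        tauto
    have e1 : ∑ x ∈ Xp \ X, ∑ y ∈ Y, (g x y - h x y) ≤ ((Xp \ X).card : ℝ) * n := by
      apply bd
      intro x _
      calc ∑ y ∈ Y, (g x y - h x y) ≤ Y.card * 1 :=
            bd _ _ _ (fun y _ => by linarith [h0 x y, g1 x y])
        _ ≤ n := by linarith
    have e2 : ∑ x ∈ Xpᶜ, ∑ y ∈ Y, (g x y - h x y) ≤ ((Xpᶜ).card : ℝ) * m := by
      apply bd
      intro x hx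
      exact hX' x (by simpa using hx)
    have e3 : ((Xp \ X).card : ℝ) ≤ m := by
      rw [card_sdiff_of_subset hXp, Nat.cast_sub (card_le_card hXp)]
      linarith
    have e4 : ((Xpᶜ).card : ℝ) ≤ n := by rw [hn]; exact_mod_cast card_le_univ _
    have := mul_le_mul_of_nonneg_right e3 (X0.trans Xn)
    have := mul_le_mul_of_nonneg_right e4 hm0
    linarith
  have a7 : ∑ x ∈ Xᶜ, ∑ y ∈ Y, (g x y - h x y)
      = ∑ x ∈ Xᶜ, ∑ y ∈ Y, g x y - ∑ x ∈ Xᶜ, ∑ y ∈ Y, h x y := by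
    simp only [sum_sub_distrib]
  -- G edges at Y
  have b1 : Y.card * (c - s) ≤ ∑ y ∈ Y, ∑ x, g y x := bd' _ _ _ (fun y _ => hlo y)
  have b2 : ∑ y ∈ Y, ∑ x, g y x = ∑ x ∈ X, ∑ y ∈ Y, g x y + ∑ x ∈ Xᶜ, ∑ y ∈ Y, g x y := by
    rw [sum_comm, sp X]
    congr 1 <;> exact sum_congr rfl (fun x _ => sum_congr rfl (fun y _ => gs _ _))
  have b3 : ∑ x ∈ X, ∑ y ∈ Y, g x y ≤ X.card * (c + s) := by
    apply bd
    intro x _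
    refine le_trans ?_ (hhi x)
    exact sum_le_sum_of_subset_of_nonneg (subset_univ _) (fun b _ _ => g0 x b)
  have rowle : ∀ (S : Finset V) x, ∑ y ∈ S, g x y ≤ S.card := fun S x => by
    simpa using bd S (g x) 1 (fun y _ => g1 x y)
  have b4 : ∑ x ∈ X, ∑ y ∈ Y, g x y ≤ X.card * Y.card := bd _ _ _ (fun x _ => rowle Y x)
  -- G edges at X complement
  have c1 : (n - X.card) * (c - s) ≤ ∑ x ∈ Xᶜ, ∑ y, g x y := by
    rw [← cX]; exact bd' _ _ _ (fun y _ => hlo y)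
  have c2 : ∑ x ∈ Xᶜ, ∑ y, g x y = ∑ x ∈ Xᶜ, ∑ y ∈ Y, g x y + ∑ x ∈ Xᶜ, ∑ y ∈ Yᶜ, g x y := by
    rw [← sum_add_distrib]; exact sum_congr rfl (fun x _ => sp Y _)
  have c3 : ∑ x ∈ Xᶜ, ∑ y ∈ Yᶜ, g x y ≤ (n - X.card) * (n - Y.card) := by
    rw [← cX, ← cY]; exact bd _ _ _ (fun x _ => rowle _ x)
  refine ⟨?_, ?_, ?_, ?_, ?_, ?_, ?_, ?_, Xn, Yn⟩
  · have := mul_nonneg Y0 hm0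
    nlinarith
  · have := mul_le_mul_of_nonneg_right Xn hs0
    have := mul_le_mul_of_nonneg_right Yn hs0
    nlinarith
  · exact sum_nonneg (fun x _ => sum_nonneg (fun y _ => g0 x y))
  · have h1 := hlo v
    rw [sp X] at h1
    have h2 : ∑ b ∈ Xᶜ, g v b = ∑ b ∈ Xᶜ, h v b :=
      sum_congr rfl (fun b hb => hv b (by simpa using hb))
    have h3 := hd v
    rw [sp X] at h3
    have h4 : 0 ≤ ∑ b ∈ X, h v b := sum_nonneg (fun b _ => h0 v b)
    have := rowle X v
    linarith
  · linarith
  · have h1 := hlo w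
    rw [sp Y] at h1
    have h2 := hX' w hw
    rw [sum_sub_distrib] at h2
    have h3 := hd w
    rw [sp Y] at h3
    have h4 : 0 ≤ ∑ b ∈ Yᶜ, h w b := sum_nonneg (fun b _ => h0 w b)
    have := rowle Yᶜ w
    linarith
  · linarith
  · have h1 := hlo v
    have h2 := rowle univ v
    rw [card_univ, ← hn] at h2
    linarith

lemma arith (n D m s c a b E δ ε κ η : ℝ) (hn : 0 < n) (hε : 0 < ε) (hκ : 0 < κ)
    (hη : 0 < η) (hδ : 0 < δ) (hs0 : 0 ≤ s) (hm0 : 0 ≤ m)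
    (i1 : E ≤ D * (b - a) + n + 3 * m * n) (i2 : c * (b - a) - 2 * s * n ≤ E) (i3 : 0 ≤ E)
    (i4 : c - s - D ≤ a) (i5 : (c - s) * b ≤ a * b + E) (i6 : c - s - D - m ≤ n - b)
    (i7 : (c - s) * (n - a) ≤ E + (n - a) * (n - b)) (i8 : c - s ≤ n)
    (hL : 1 + 3 * m + 2 * s ≤ 4 * δ * n) (hD : D ≤ c - ε * n / 2 - s - m)
    (hDκ : κ * n ≤ D) (d1 : 16 * δ ≤ η * ε) (d2 : 8 * δ ≤ η) (d3 : 4 * δ ≤ η * κ)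
    (e1 : η ≤ ε / 4) (e2 : s + 4 * η / ε * n ≤ c / 2) (e3 : η * n ≤ c / 6) :
    E ≤ η * n ^ 2 ∧ a - b ≤ η * n ∧ c / 3 ≤ b ∧ c / 3 ≤ n - a := by
  have hLn : n + 3 * m * n + 2 * s * n ≤ 4 * δ * n * n := by
    have := mul_le_mul_of_nonneg_right hL hn.le
    linarith
  have hsn := mul_nonneg hs0 hn.le
  have hmn := mul_nonneg hm0 hn.le
  have hD0 : 0 < D := lt_of_lt_of_le (mul_pos hκ hn) hDκ
  have hηn := mul_pos hη hn
  have hDn : D ≤ n := by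
    have := mul_pos hε hn
    linarith
  have hE : E ≤ D * (b - a) + 4 * δ * n * n := by linarith
  have hba : b - a ≤ η / 2 * n := by
    by_contra hcon
    push Not at hcon
    have hpos : 0 < b - a := by linarith
    have k1 : (c - D) * (b - a) ≤ 4 * δ * n * n := by linarith
    have k2 : ε * n / 2 * (b - a) ≤ (c - D) * (b - a) :=
      mul_le_mul_of_nonneg_right (by linarith) hpos.le
    have k3 : ε * n / 2 * (η / 2 * n) < ε * n / 2 * (b - a) :=
      mul_lt_mul_of_pos_left hcon (by positivity)
    have k4 : 16 * δ * (n * n) ≤ η * ε * (n * n) := mul_le_mul_of_nonneg_right d1 (by positivity)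
    nlinarith
  have hEn : E ≤ η * n ^ 2 := by
    have k4 : 8 * δ * (n * n) ≤ η * (n * n) := mul_le_mul_of_nonneg_right d2 (by positivity)
    have k5 : D * (b - a) ≤ D * (η / 2 * n) := mul_le_mul_of_nonneg_left hba hD0.le
    have k6 : D * (η / 2 * n) ≤ n * (η / 2 * n) := mul_le_mul_of_nonneg_right hDn (by positivity)
    nlinarith
  have hab : a - b ≤ η * n := by
    have k1 : D * (a - b) ≤ 4 * δ * n * n := by linarith
    by_contra hcon
    push Not at hcon
    have k2 : D * (η * n) < D * (a - b) := mul_lt_mul_of_pos_left hcon hD0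
    have k3 : κ * n * (η * n) ≤ D * (η * n) := mul_le_mul_of_nonneg_right hDκ hηn.le
    have k4 : 4 * δ * (n * n) ≤ η * κ * (n * n) := mul_le_mul_of_nonneg_right d3 (by positivity)
    nlinarith
  have hηε : η * n ≤ ε / 4 * n := mul_le_mul_of_nonneg_right e1 hn.le
  have gen : ∀ p q : ℝ, ε * n / 4 ≤ p → (c - s - q) * p ≤ η * n ^ 2 → c / 2 ≤ q := by
    intro p q hp hq
    by_contra hcon
    push Not at hcon
    have k1 : 4 * η / ε * n < c - s - q := by linarith
    have k0 : 0 < 4 * η / ε * n := by positivity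
    have k2 : (4 * η / ε * n) * (ε * n / 4) < (c - s - q) * p :=
      mul_lt_mul k1 hp (by positivity) (by linarith)
    have k3 : (4 * η / ε * n) * (ε * n / 4) = η * n ^ 2 := by field_simp
    linarith
  have ha : c / 2 ≤ a := gen b a (by linarith) (by linarith)
  have hb : c / 2 ≤ n - b := gen (n - a) (n - b) (by linarith) (by linarith)
  refine ⟨hEn, hab, by linarith, by linarith⟩

lemma finish (g : V → V → ℝ) (gs : ∀ a b, g a b = g b a) (g1 : ∀ a b, g a b ≤ 1)
    (X Y : Finset V) (n c η γ : ℝ) (hn : n = Fintype.card V) (hn0 : 0 < n) (hη : 0 < η)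
    (hγ : 2 * η < γ)
    (hE : ∑ x ∈ Xᶜ, ∑ y ∈ Y, g x y ≤ η * n ^ 2) (hab : (X.card : ℝ) - Y.card ≤ η * n)
    (hb : c / 3 ≤ Y.card) (ha : c / 3 ≤ n - X.card)
    (hexp : ∀ A B : Finset V, c / 3 ≤ (A.card : ℝ) → n / 2 ≤ (B.card : ℝ) →
      γ * n ^ 2 ≤ ∑ x ∈ A, ∑ y ∈ B, g x y) : False := by
  have cX : ((Xᶜ).card : ℝ) = n - X.card := by
    rw [card_compl, Nat.cast_sub (card_le_univ X), hn]
  have hn2 : 0 < n ^ 2 := by positivity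
  have hηγ : 2 * η * n ^ 2 < γ * n ^ 2 := mul_lt_mul_of_pos_right hγ hn2
  have hη2 : 0 < η * n ^ 2 := by positivity
  by_cases hX : n / 2 ≤ n - X.card
  · have h1 := hexp Y Xᶜ hb (by rw [cX]; exact hX)
    rw [sum_comm] at h1
    have h2 : ∑ x ∈ Xᶜ, ∑ y ∈ Y, g y x = ∑ x ∈ Xᶜ, ∑ y ∈ Y, g x y :=
      sum_congr rfl (fun x _ => sum_congr rfl (fun y _ => gs _ _))
    linarith
  · push Not at hX
    have : ∃ Z : Finset V, Y ⊆ Z ∧ n / 2 ≤ (Z.card : ℝ) ∧ ((Z \ Y).card : ℝ) ≤ η * n := by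
      by_cases hYX : X.card ≤ Y.card
      · refine ⟨Y, subset_rfl, ?_, ?_⟩
        · have : (X.card : ℝ) ≤ Y.card := by exact_mod_cast hYX
          linarith
        · simp; positivity
      · obtain ⟨Z, hZ, hZc⟩ := exists_superset_card_eq (s := Y) (n := X.card)
          (by omega) (card_le_univ X)
        refine ⟨Z, hZ, ?_, ?_⟩
        · rw [hZc]; linarith
        · rw [card_sdiff_of_subset hZ, Nat.cast_sub (card_le_card hZ), hZc]
          exact hab
    obtain ⟨Z, hYZ, hZ, hZY⟩ := this
    have h1 := hexp Xᶜ Z (by rw [cX]; exact ha) hZ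
    have h2 : ∑ x ∈ Xᶜ, ∑ y ∈ Z, g x y
        = ∑ x ∈ Xᶜ, ∑ y ∈ Z \ Y, g x y + ∑ x ∈ Xᶜ, ∑ y ∈ Y, g x y := by
      rw [← sum_add_distrib]
      exact sum_congr rfl (fun x _ => (sum_sdiff hYZ).symm)
    have h3 : ∑ x ∈ Xᶜ, ∑ y ∈ Z \ Y, g x y ≤ ((Xᶜ).card : ℝ) * (η * n) := by
      have := sum_le_card_nsmul Xᶜ (fun x => ∑ y ∈ Z \ Y, g x y) (η * n) (fun x _ => by
        have := sum_le_card_nsmul (Z \ Y) (g x) 1 (fun y _ => g1 x y)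
        simp only [nsmul_eq_mul, mul_one] at this
        linarith)
      simpa using this
    have h4 : ((Xᶜ).card : ℝ) * (η * n) ≤ n * (η * n) := by
      apply mul_le_mul_of_nonneg_right _ (by positivity)
      rw [hn]; exact_mod_cast card_le_univ _
    nlinarith

/-- Indicator of adjacency. -/
noncomputable def ind (G : SimpleGraph V) (a b : V) : ℝ := if G.Adj a b then 1 else 0

lemma sum_ind (G : SimpleGraph V) (u : V) : ∑ b, ind G u b = dg G u := by
  simp [ind, dg]

lemma eBetween_le (G : SimpleGraph V) (A B : Finset V) :
    (eBetween G (A : Set V) (B : Set V) : ℝ) ≤ ∑ x ∈ A, ∑ y ∈ B, ind G x y := by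
  have h1 : ∑ x ∈ A, ∑ y ∈ B, ind G x y
      = (((A ×ˢ B).filter (fun p => G.Adj p.1 p.2)).card : ℝ) := by
    rw [← sum_product']
    simp [ind]
  rw [h1]
  unfold eBetween
  have h2 : {e ∈ G.edgeSet | ∃ a ∈ (A : Set V), ∃ b ∈ (B : Set V), e = s(a, b)}
      ⊆ (((A ×ˢ B).filter (fun p => G.Adj p.1 p.2)).image (fun p => s(p.1, p.2)) :
        Finset (Sym2 V)) := by
    rintro e ⟨he, a, ha, b, hb, rfl⟩
    simp only [coe_image, Set.mem_image]
    refine ⟨(a, b), ?_, rfl⟩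
    simp only [coe_filter, mem_product, Set.mem_ofPred_eq]
    exact ⟨⟨by simpa using ha, by simpa using hb⟩, by simpa using he⟩
  have h3 := Set.ncard_le_ncard h2 (Finset.finite_toSet _)
  rw [Set.ncard_coe_finset] at h3
  exact_mod_cast h3.trans card_image_le

lemma core_result (G : SimpleGraph V) (d m N : ℕ) (n s c δ ε κ η γ : ℝ) (hn : n = Fintype.card V)
    (hn0 : 0 < n) (hε : 0 < ε) (hκ : 0 < κ) (hη : 0 < η) (hδ : 0 < δ) (hs0 : 0 ≤ s)
    (hN : Fintype.card V < N * m) (hm : N + 1 < m)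
    (hL : 1 + 3 * (m : ℝ) + 2 * s ≤ 4 * δ * n) (hD : 2 * (d : ℝ) ≤ c - ε * n / 2 - s - m)
    (hDκ : κ * n ≤ 2 * d) (d1 : 16 * δ ≤ η * ε) (d2 : 8 * δ ≤ η) (d3 : 4 * δ ≤ η * κ)
    (e1 : η ≤ ε / 4) (e2 : s + 4 * η / ε * n ≤ c / 2) (e3 : η * n ≤ c / 6) (hγ : 2 * η < γ)
    (hlo : ∀ u, c - s ≤ dg G u) (hhi : ∀ u, dg G u ≤ c + s)
    (hexp : ∀ A B : Finset V, c / 3 ≤ (A.card : ℝ) → n / 2 ≤ (B.card : ℝ) →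
      γ * n ^ 2 ≤ (eBetween G (A : Set V) (B : Set V) : ℝ)) :
    ∃ H ≤ G, ∀ u, dg H u = 2 * d := by
  by_contra hreg
  obtain ⟨H, X, Y, Xp, v, w, hHG, hd, hv, hXp, hXpc, hw, hx, hY, hX'⟩ :=
    obstruction_exists G d m N hN hm hreg
  have symG : ∀ (K : SimpleGraph V) a b, ind K a b = ind K b a := fun K a b => by
    simp [ind, K.adj_comm]
  have le1 : ∀ a b, ind G a b ≤ 1 := fun a b => by unfold ind; split_ifs <;> norm_num
  have key := counting (ind G) (ind H) (symG G) (symG H)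
    (fun a b => by unfold ind; split_ifs <;> norm_num)
    (fun a b => by
      unfold ind
      by_cases h : H.Adj a b
      · simp [h, hHG h]
      · simp only [h, if_false]; split_ifs <;> norm_num)
    le1 X Y Xp v w n (2 * d) m s c hn hs0 (Nat.cast_nonneg m)
    (fun u => by rw [sum_ind]; exact_mod_cast hd u)
    (fun x hxX => by
      rw [sum_ind]
      have : (2 * (d : ℝ)) ≤ dg H x + 1 := by exact_mod_cast hx x hxX
      linarith)
    (fun x hxX => by
      unfold ind
      by_cases h : H.Adj v x
      · simp [h, hHG h]
      · have : ¬ G.Adj v x := fun h' => hxX (hv x h' h)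
        simp [h, this])
    hXp (by exact_mod_cast hXpc) hw
    (fun y hy => by
      have h1 : ∑ z ∈ X, ind H y z = ((univ.filter (fun z => H.Adj y z ∧ z ∈ X)).card : ℝ) := by
        simp only [ind, sum_boole]
        congr 2
        ext z
        simp [and_comm]
      rw [h1]
      exact_mod_cast hY y hy)
    (fun x hx => by
      have h1 : ∑ y ∈ Y, (ind G x y - ind H x y)
          = ((univ.filter (fun y => (G.Adj x y ∧ ¬ H.Adj x y) ∧ y ∈ Y)).card : ℝ) := by
        have : ∀ y, ind G x y - ind H x y = if (G.Adj x y ∧ ¬ H.Adj x y) then 1 else 0 := by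
          intro y
          unfold ind
          by_cases h : H.Adj x y
          · simp [h, hHG h]
          · simp [h]
        simp only [this, sum_boole]
        congr 2
        ext z
        simp [and_comm]
      rw [h1]
      exact_mod_cast hX' x hx)
    (fun u => by rw [sum_ind]; exact hlo u) (fun u => by rw [sum_ind]; exact hhi u)
  obtain ⟨i1, i2, i3, i4, i5, i6, i7, i8, -, -⟩ := key
  obtain ⟨f1, f2, f3, f4⟩ := arith n (2 * d) m s c X.card Y.card _ δ ε κ η hn0 hε hκ hη hδ hs0
    (Nat.cast_nonneg m) i1 i2 i3 i4 i5 i6 i7 i8 hL hD hDκ d1 d2 d3 e1 e2 e3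
  exact finish (ind G) (symG G) le1 X Y n c η γ hn hn0 hη hγ f1 f2 f3 f4
    (fun A B hA hB => (hexp A B hA hB).trans (eBetween_le G A B))

lemma eventually_pow (τ : ℝ) (hτ : 0 < τ) :
    ∃ n₁ : ℕ, ∀ n : ℕ, n₁ ≤ n → (n : ℝ) ^ ((2 : ℝ) / 3) ≤ τ * n := by
  have h1 := (tendsto_rpow_neg_atTop (y := (1 : ℝ) / 3) (by norm_num)).comp
    (tendsto_natCast_atTop_atTop (R := ℝ))
  have h2 := (h1.eventually (gt_mem_nhds hτ)).and (Filter.eventually_gt_atTop 0)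
  obtain ⟨n₁, hn₁⟩ := Filter.eventually_atTop.1 h2
  refine ⟨n₁, fun n hn => ?_⟩
  obtain ⟨h3, h4⟩ := hn₁ n hn
  have h5 : (0 : ℝ) < n := by exact_mod_cast h4
  have h6 : (n : ℝ) ^ ((2 : ℝ) / 3) = (n : ℝ) ^ (-((1 : ℝ) / 3)) * n := by
    rw [← Real.rpow_add_one h5.ne']
    norm_num
  rw [h6]
  exact mul_le_mul_of_nonneg_right (le_of_lt h3) h5.le

end RegSub

/-- Lemma 1.4 of the paper. Let `ε₀, γ₀ > 0` with `c₀ ≥ ε₀` and let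
`n` be sufficiently large. If `G*` is an `n`-vertex graph with all degrees between
`c₀ n - n^(2/3)` and `c₀ n + n^(2/3)`, with at least `γ₀ n²` edges between any two
sets `A, B` with `|A| ≥ c₀ n / 3` and `|B| ≥ n/2`, then `G*` has a regular spanning
subgraph of degree `2d` where `d = ⌈(c₀ - ε₀) n / 2⌉`. -/
theorem regular_spanning_subgraph (ε₀ γ₀ c₀ : ℝ) (hε₀ : 0 < ε₀) (hγ₀ : 0 < γ₀)
    (hc₀ : ε₀ ≤ c₀) :
    ∃ n₀ : ℕ, ∀ n : ℕ, n₀ ≤ n → ∀ G : SimpleGraph (Fin n),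
      (∀ v : Fin n, c₀ * (n : ℝ) - (n : ℝ) ^ ((2 : ℝ) / 3) ≤ (degN G v : ℝ) ∧
        (degN G v : ℝ) ≤ c₀ * (n : ℝ) + (n : ℝ) ^ ((2 : ℝ) / 3)) →
      (∀ A B : Set (Fin n), c₀ * (n : ℝ) / 3 ≤ (A.ncard : ℝ) →
        (n : ℝ) / 2 ≤ (B.ncard : ℝ) → γ₀ * (n : ℝ) ^ 2 ≤ (eBetween G A B : ℝ)) →
      ∃ G' : SimpleGraph (Fin n), G' ≤ G ∧
        IsRegN G' (2 * ⌈(c₀ - ε₀) * (n : ℝ) / 2⌉₊) := by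
  rcases hc₀.eq_or_lt with heq | hlt
  · refine ⟨0, fun n _ G _ _ => ⟨⊥, bot_le, fun v => ?_⟩⟩
    subst heq
    simp [RegSub.dg_eq_degN, RegSub.dg]
  have hκ : 0 < c₀ - ε₀ := sub_pos.2 hlt
  have hc : 0 < c₀ := hε₀.trans hlt
  obtain ⟨η, hη, e1, e2, e3, e4⟩ : ∃ η : ℝ, 0 < η ∧ η ≤ ε₀ / 4 ∧ η ≤ ε₀ * c₀ / 32 ∧
      η ≤ c₀ / 6 ∧ η ≤ γ₀ / 3 := by
    refine ⟨min (min (ε₀ / 4) (ε₀ * c₀ / 32)) (min (c₀ / 6) (γ₀ / 3)), by positivity,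
      ?_, ?_, ?_, ?_⟩ <;> simp
  obtain ⟨δ, hδ, d1, d2, d3, d4⟩ : ∃ δ : ℝ, 0 < δ ∧ δ ≤ η * ε₀ / 16 ∧ δ ≤ η / 8 ∧
      δ ≤ η * (c₀ - ε₀) / 4 ∧ δ ≤ ε₀ / 8 := by
    refine ⟨min (min (η * ε₀ / 16) (η / 8)) (min (η * (c₀ - ε₀) / 4) (ε₀ / 8)), by positivity,
      ?_, ?_, ?_, ?_⟩ <;> simp
  obtain ⟨n₁, hn₁⟩ := RegSub.eventually_pow (min (δ / 4) (c₀ / 4)) (by positivity)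
  refine ⟨max n₁ ⌈((⌈2 / δ⌉₊ : ℝ) + 9) / δ⌉₊, fun n hn G hdeg hexp => ?_⟩
  have hs := hn₁ n (le_trans (le_max_left _ _) hn)
  have hbig : ((⌈2 / δ⌉₊ : ℝ) + 9) / δ ≤ n :=
    Nat.ceil_le.1 (le_trans (le_max_right _ _) hn)
  have hbig' : (⌈2 / δ⌉₊ : ℝ) + 9 ≤ δ * n := by
    rw [div_le_iff₀ hδ] at hbig; linarith
  have hN0 : (0 : ℝ) ≤ (⌈2 / δ⌉₊ : ℝ) := Nat.cast_nonneg _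
  have hn0 : (0 : ℝ) < n := lt_of_lt_of_le (by positivity) hbig
  have hs0 : (0 : ℝ) ≤ (n : ℝ) ^ ((2 : ℝ) / 3) := by positivity
  have hs1 : (n : ℝ) ^ ((2 : ℝ) / 3) ≤ δ / 4 * n :=
    hs.trans (mul_le_mul_of_nonneg_right (min_le_left _ _) hn0.le)
  have hs2 : (n : ℝ) ^ ((2 : ℝ) / 3) ≤ c₀ / 4 * n :=
    hs.trans (mul_le_mul_of_nonneg_right (min_le_right _ _) hn0.le)
  have hm1 : δ * n ≤ (⌈δ * n⌉₊ : ℝ) := Nat.le_ceil _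
  have hm2 : (⌈δ * n⌉₊ : ℝ) < δ * n + 1 := Nat.ceil_lt_add_one (by positivity)
  have hd1 : (c₀ - ε₀) * (n : ℝ) / 2 ≤ (⌈(c₀ - ε₀) * (n : ℝ) / 2⌉₊ : ℝ) := Nat.le_ceil _
  have hd2 : (⌈(c₀ - ε₀) * (n : ℝ) / 2⌉₊ : ℝ) < (c₀ - ε₀) * (n : ℝ) / 2 + 1 :=
    Nat.ceil_lt_add_one (by positivity)
  have hδε : δ * n ≤ ε₀ / 8 * n := mul_le_mul_of_nonneg_right d4 hn0.le
  obtain ⟨H, hH, hreg⟩ := RegSub.core_result G ⌈(c₀ - ε₀) * (n : ℝ) / 2⌉₊ ⌈δ * n⌉₊ ⌈2 / δ⌉₊ n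
    ((n : ℝ) ^ ((2 : ℝ) / 3)) (c₀ * n) δ ε₀ (c₀ - ε₀) η γ₀ (by simp) hn0 hε₀ hκ hη hδ hs0
    (by
      rw [Fintype.card_fin]
      have h1 : (2 / δ) * (δ * n) ≤ (⌈2 / δ⌉₊ : ℝ) * (⌈δ * n⌉₊ : ℝ) :=
        mul_le_mul (Nat.le_ceil _) hm1 (by positivity) hN0
      have h2 : (2 / δ) * (δ * n) = 2 * n := by field_simp
      have h3 : (n : ℝ) < (⌈2 / δ⌉₊ : ℝ) * (⌈δ * n⌉₊ : ℝ) := by linarith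
      exact_mod_cast h3)
    (by
      have h3 : (⌈2 / δ⌉₊ : ℝ) + 1 < (⌈δ * n⌉₊ : ℝ) := by linarith
      exact_mod_cast h3)
    (by linarith) (by linarith) (by linarith) (by linarith) (by linarith) (by linarith) e1
    (by
      have h1 : 4 * η / ε₀ ≤ c₀ / 8 := by
        rw [div_le_iff₀ hε₀]; linarith
      have h2 := mul_le_mul_of_nonneg_right h1 hn0.le
      linarith)
    (by have := mul_le_mul_of_nonneg_right e3 hn0.le; linarith) (by linarith)
    (fun u => by rw [← RegSub.dg_eq_degN]; exact (hdeg u).1)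
    (fun u => by rw [← RegSub.dg_eq_degN]; exact (hdeg u).2)
    (fun A B hA hB => hexp A B (by rw [Set.ncard_coe_finset]; exact hA)
      (by rw [Set.ncard_coe_finset]; exact hB))
  exact ⟨H, hH, fun v => by rw [RegSub.dg_eq_degN]; exact hreg v⟩
end

section
/- Let c > 0, ε > 0 and 0 < δ ≤ εc/5 be constants and let n be sufficiently large. Let G and F be edge-disjoint graphs on the vertex set [n] such that G is d-regular with d ≥ εcn, and such that for any two sets A, B ⊆ [n] with |A| ≥ δ²n and |B| ≥ (1/2 - δ)n there is at least one edge of F between A and B. Let H be a partial HC in G ∪ F. Then one of the following holds: (1) there exist edges e, e₁, e₂ ∈ (G ∪ F) \ H and e', e₁', e₂' ∈ H such that H ∪ {e} \ {e'}, or H ∪ {e}, or H ∪ {e, e₁, e₂} \ {e', e₁', e₂'}, or H ∪ {e, e₁, e₂} \ {e₁', e₂'} is a partial HC with one fewer connected component than H and at least as many edges as H; or (2) there exist edges e₁, e₂, e₃ ∈ (G ∪ F) \ H, edges e₁', e₂', e₃' ∈ H, and an edge f ∈ F \ H such that H ∪ {e₁, e₂, e₃, f} \ {e₁', e₂', e₃'}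 is a (≤2)-factor in G ∪ F with the same number of connected components as H and one more edge than H. -/
open SimpleGraph

/-- The graph obtained from `H` by adding the edges in `add` and then deleting
the edges in `del`. -/
def modifyGraph {V : Type*} (H : SimpleGraph V) (add del : Set (Sym2 V)) : SimpleGraph V :=
  SimpleGraph.fromEdgeSet ((H.edgeSet ∪ add) \ del)

/-- The connected component `c` of `H` is a cycle (all its vertices have degree 2). -/
def IsCycleComp {V : Type*} (H : SimpleGraph V) (c : H.ConnectedComponent) : Prop :=
  ∀ v ∈ c.supp, degN H v = 2

/-- The connected component `c` of `H` is a single (isolated) edge. -/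
def IsEdgeComp {V : Type*} (H : SimpleGraph V) (c : H.ConnectedComponent) : Prop :=
  c.supp.ncard = 2

/-- The connected component `c` of `H` is a path (in a graph of maximum degree `≤ 2`:
it contains a vertex of degree at most 1). -/
def IsPathComp {V : Type*} (H : SimpleGraph V) (c : H.ConnectedComponent) : Prop :=
  ∃ v ∈ c.supp, degN H v ≤ 1

/-- `H` is a partial Hamilton cycle (partial HC): one of its connected components is
a path and all of its other components are cycles or isolated edges. -/
def IsPartialHC {V : Type*} (H : SimpleGraph V) : Prop :=
  (∀ v, degN H v ≤ 2) ∧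
  ∃ c : H.ConnectedComponent, IsPathComp H c ∧
    ∀ c' : H.ConnectedComponent, c' ≠ c → IsCycleComp H c' ∨ IsEdgeComp H c'

/-- `H` is a `(≤2)`-factor: every connected component is a cycle or an isolated edge. -/
def IsLe2Factor {V : Type*} (H : SimpleGraph V) : Prop :=
  ∀ c : H.ConnectedComponent, IsCycleComp H c ∨ IsEdgeComp H c

/-- The number of connected components of `H`. -/
noncomputable def numComp {V : Type*} (H : SimpleGraph V) : ℕ :=
  Nat.card H.ConnectedComponent

/-- `K` is a partial HC with one fewer connected component than `H` and at least as
many edges as `H`. -/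
def GoodStep {V : Type*} (H K : SimpleGraph V) : Prop :=
  IsPartialHC K ∧ numComp K + 1 = numComp H ∧ H.edgeSet.ncard ≤ K.edgeSet.ncard


open Classical in
noncomputable def ind {V : Type*} (a b : V) : ℕ := if a = b then 1 else 0

lemma ind_self {V : Type*} (a : V) : ind a a = 1 := by simp [ind]

lemma ind_ne {V : Type*} {a b : V} (h : a ≠ b) : ind a b = 0 := by simp [ind, h]

lemma mod_adj {V : Type*} {H : SimpleGraph V} {A D : Set (Sym2 V)} {a b : V} :
    (modifyGraph H A D).Adj a b ↔ ((H.Adj a b ∨ s(a, b) ∈ A) ∧ s(a, b) ∉ D) ∧ a ≠ b := by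
  rw [modifyGraph, SimpleGraph.fromEdgeSet_adj]
  rfl

lemma mod_mod {V : Type*} (H : SimpleGraph V) (A D A' D' : Set (Sym2 V))
    (h : ∀ e ∈ A', e ∉ D) :
    modifyGraph (modifyGraph H A D) A' D' = modifyGraph H (A ∪ A') (D ∪ D') := by
  ext a b
  simp only [mod_adj, Set.mem_union]
  have := h s(a, b)
  tauto

lemma edgeSet_mod {V : Type*} (H : SimpleGraph V) (A D : Set (Sym2 V))
    (hA : ∀ e ∈ A, ¬ e.IsDiag) :
    (modifyGraph H A D).edgeSet = (H.edgeSet ∪ A) \ D := by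
  ext e
  induction e with
  | _ a b =>
    rw [SimpleGraph.mem_edgeSet, mod_adj]
    simp only [Set.mem_sdiff, Set.mem_union, SimpleGraph.mem_edgeSet]
    have h1 : s(a, b) ∈ A → a ≠ b := fun h => by simpa using hA _ h
    have h2 : H.Adj a b → a ≠ b := fun h => h.ne
    tauto

lemma degN_add {V : Type*} [Finite V] (H : SimpleGraph V) {a b : V} (hab : a ≠ b)
    (hn : ¬ H.Adj a b) (v : V) :
    degN (modifyGraph H {s(a, b)} ∅) v = degN H v + ind v a + ind v b := by
  classical
  unfold degN
  by_cases h1 : v = a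
  · subst h1
    rw [ind_self, ind_ne hab, add_zero]
    have : (modifyGraph H {s(v, b)} ∅).neighborSet v = insert b (H.neighborSet v) := by
      ext w
      simp only [SimpleGraph.mem_neighborSet, mod_adj, Set.mem_insert_iff, Set.mem_singleton_iff,
        Set.mem_empty_iff_false, not_false_iff, and_true]
      constructor
      · rintro ⟨h | h, h'⟩
        · exact Or.inr h
        · left; simp only [Sym2.eq_iff] at h; grind
      · rintro (h | h)
        · subst h; exact ⟨Or.inr rfl, hab⟩
        · exact ⟨Or.inl h, h.ne⟩
    rw [this, Set.ncard_insert_of_notMem (by simpa using hn) (Set.toFinite _)]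
  · by_cases h2 : v = b
    · subst h2
      rw [ind_self, ind_ne h1, add_zero]
      have : (modifyGraph H {s(a, v)} ∅).neighborSet v = insert a (H.neighborSet v) := by
        ext w
        simp only [SimpleGraph.mem_neighborSet, mod_adj, Set.mem_insert_iff,
          Set.mem_singleton_iff, Set.mem_empty_iff_false, not_false_iff, and_true]
        constructor
        · rintro ⟨h | h, h'⟩
          · exact Or.inr h
          · left; simp only [Sym2.eq_iff] at h; grind
        · rintro (h | h)
          · subst h; exact ⟨Or.inr Sym2.eq_swap, h1⟩
          · exact ⟨Or.inl h, h.ne⟩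
      rw [this, Set.ncard_insert_of_notMem (by simpa using fun h => hn (SimpleGraph.Adj.symm h))
        (Set.toFinite _)]
    · rw [ind_ne h1, ind_ne h2]
      congr 1
      ext w
      simp only [SimpleGraph.mem_neighborSet, mod_adj, Set.mem_singleton_iff,
        Set.mem_empty_iff_false, not_false_iff, and_true]
      constructor
      · rintro ⟨h | h, h'⟩
        · exact h
        · simp only [Sym2.eq_iff] at h; grind
      · intro h; exact ⟨Or.inl h, h.ne⟩

lemma degN_del {V : Type*} [Finite V] (H : SimpleGraph V) {a b : V} (h : H.Adj a b) (v : V) :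
    degN (modifyGraph H ∅ {s(a, b)}) v + ind v a + ind v b = degN H v := by
  have hn : ¬ (modifyGraph H ∅ {s(a, b)}).Adj a b := by simp [mod_adj]
  rw [← degN_add _ h.ne hn v, ]
  congr 1
  ext c d
  simp only [mod_adj, Set.mem_singleton_iff, Set.mem_empty_iff_false, not_false_iff, and_true,
    or_false]
  constructor
  · rintro ⟨h1 | h1, h2⟩
    · exact h1.1.1
    · rw [Sym2.eq_iff] at h1
      rcases h1 with ⟨rfl, rfl⟩ | ⟨rfl, rfl⟩
      · exact h
      · exact h.symm
  · intro h1
    have := h1.ne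
    tauto

lemma degN_swap {V : Type*} [Finite V] (H : SimpleGraph V) {a b c d : V} (hab : a ≠ b)
    (hn : ¬ H.Adj a b) (h : H.Adj c d) (v : V) :
    degN (modifyGraph H {s(a, b)} {s(c, d)}) v + ind v c + ind v d
      = degN H v + ind v a + ind v b := by
  have hne : s(a, b) ≠ s(c, d) := by
    intro h'
    rw [← SimpleGraph.mem_edgeSet, ← h'] at h
    exact hn h
  have e : modifyGraph H {s(a, b)} {s(c, d)}
      = modifyGraph (modifyGraph H {s(a, b)} ∅) ∅ {s(c, d)} := by
    rw [mod_mod _ _ _ _ _ (by simp)]; simp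
  rw [e, degN_del, degN_add H hab hn]
  simp only [mod_adj]
  exact ⟨⟨Or.inl h, by simp⟩, h.ne⟩

lemma edges_swap {V : Type*} [Finite V] (H : SimpleGraph V) {a b c d : V} (hab : a ≠ b)
    (hn : ¬ H.Adj a b) (h : H.Adj c d) :
    (modifyGraph H {s(a, b)} {s(c, d)}).edgeSet.ncard = H.edgeSet.ncard := by
  have h' : s(c, d) ∈ H.edgeSet := h
  have hn' : s(a, b) ∉ H.edgeSet := hn
  rw [edgeSet_mod _ _ _ (by simpa using hab), Set.union_singleton,
    Set.ncard_sdiff_singleton_of_mem (by simp [h]), Set.ncard_insert_of_notMem hn' (Set.toFinite _)]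
  simp

lemma edges_add {V : Type*} [Finite V] (H : SimpleGraph V) {a b : V} (hab : a ≠ b)
    (hn : ¬ H.Adj a b) :
    (modifyGraph H {s(a, b)} ∅).edgeSet.ncard = H.edgeSet.ncard + 1 := by
  have hn' : s(a, b) ∉ H.edgeSet := hn
  rw [edgeSet_mod _ _ _ (by simpa using hab), Set.union_singleton, Set.sdiff_empty,
    Set.ncard_insert_of_notMem hn' (Set.toFinite _)]

/-- Same reachability relation. -/
def SR {V : Type*} (H K : SimpleGraph V) : Prop := ∀ a b, H.Reachable a b ↔ K.Reachable a b

lemma reach_of_adj {V : Type*} {H K : SimpleGraph V} (h : ∀ a b, H.Adj a b → K.Reachable a b)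
    {a b : V} (hr : H.Reachable a b) : K.Reachable a b := by
  obtain ⟨p⟩ := hr
  induction p with
  | nil => exact .refl _
  | cons h' _ ih => exact (h _ _ h').trans ih

lemma SR.numComp {V : Type*} {H K : SimpleGraph V} (h : SR H K) : numComp H = numComp K := by
  unfold _root_.numComp
  refine Nat.card_congr ?_
  exact Quot.congr (Equiv.refl V) (fun a b => h a b)

lemma SR.ncard {V : Type*} {H K : SimpleGraph V} (h : SR H K) (v : V) :
    {u | H.Reachable v u}.ncard = {u | K.Reachable v u}.ncard := by
  congr 1; ext u; exact h v u

/-- `H` consists of a path from `x` to `y` together with cycles and isolated edges. -/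
structure St {V : Type*} (H : SimpleGraph V) (x y : V) : Prop where
  reach : H.Reachable x y
  deg : ∀ v, H.Reachable x v → degN H v + ind v x + ind v y = 2
  out : ∀ v, ¬ H.Reachable x v → degN H v = 2 ∨ {u | H.Reachable v u}.ncard = 2

lemma St.symm {V : Type*} {H : SimpleGraph V} {x y : V} (h : St H x y) : St H y x := by
  refine ⟨h.reach.symm, fun v hv => ?_, fun v hv => ?_⟩
  · have := h.deg v (h.reach.trans hv); omega
  · exact h.out v (fun h' => hv (h.reach.symm.trans h'))

lemma rotate {V : Type*} [Finite V] {H : SimpleGraph V} {x y w u : V} (h : St H x y)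
    (hwu : H.Adj w u) (hxw : ¬ H.Adj x w) (hne : x ≠ w)
    (hr : (modifyGraph H ∅ {s(w, u)}).Reachable x u) :
    St (modifyGraph H {s(x, w)} {s(w, u)}) u y ∧ SR H (modifyGraph H {s(x, w)} {s(w, u)}) ∧
    (modifyGraph H {s(x, w)} {s(w, u)}).edgeSet.ncard = H.edgeSet.ncard := by
  set K := modifyGraph H {s(x, w)} {s(w, u)} with hK
  have hxu : x ≠ u := by rintro rfl; exact hxw hwu.symm
  have hKxw : K.Adj x w := by
    rw [hK, mod_adj]
    refine ⟨⟨Or.inr rfl, ?_⟩, hne⟩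
    simp only [Set.mem_singleton_iff, Sym2.eq_iff]
    tauto
  have hle : modifyGraph H ∅ {s(w, u)} ≤ K := by
    intro a b hab
    rw [mod_adj] at *
    simp only [Set.mem_empty_iff_false, or_false] at hab
    tauto
  have hleH : modifyGraph H ∅ {s(w, u)} ≤ H := by
    intro a b hab
    rw [mod_adj] at *
    simp only [Set.mem_empty_iff_false, or_false] at hab
    tauto
  have hKwu : K.Reachable w u := hKxw.symm.reachable.trans (hr.mono hle)
  have hHxu : H.Reachable x u := hr.mono hleH
  have hHxw : H.Reachable x w := hHxu.trans hwu.symm.reachable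
  have sr : SR H K := by
    intro a b
    constructor
    · apply reach_of_adj
      intro a b hab
      by_cases hh : s(a, b) = s(w, u)
      · rw [Sym2.eq_iff] at hh
        rcases hh with ⟨rfl, rfl⟩ | ⟨rfl, rfl⟩
        · exact hKwu
        · exact hKwu.symm
      · apply Adj.reachable
        rw [hK, mod_adj]
        exact ⟨⟨Or.inl hab, hh⟩, hab.ne⟩
    · apply reach_of_adj
      intro a b hab
      rw [hK, mod_adj] at hab
      rcases hab.1.1 with h1 | h1
      · exact h1.reachable
      · rw [Set.mem_singleton_iff, Sym2.eq_iff] at h1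
        rcases h1 with ⟨rfl, rfl⟩ | ⟨rfl, rfl⟩
        · exact hHxw
        · exact hHxw.symm
  have hdeg := degN_swap H hne hxw hwu
  rw [← hK] at hdeg
  refine ⟨⟨(sr _ _).1 (hHxu.symm.trans h.reach), fun v hv => ?_, fun v hv => ?_⟩, sr,
    edges_swap H hne hxw hwu⟩
  · have h1 := h.deg v (hHxu.trans ((sr _ _).2 hv))
    have h2 := hdeg v
    omega
  · have hv' : ¬ H.Reachable x v := fun h' => hv ((sr _ _).1 (hHxu.symm.trans h'))
    have h2 := hdeg v
    rw [ind_ne (by rintro rfl; exact hv' hHxw), ind_ne (by rintro rfl; exact hv' hHxu),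
      ind_ne (by rintro rfl; exact hv' (.refl _))] at h2
    rw [← sr.ncard]
    have := h.out v hv'
    rcases this with h3 | h3
    · left; omega
    · exact Or.inr h3

lemma le2_of {V : Type*} {K : SimpleGraph V}
    (c : K.ConnectedComponent)
    (h : ∀ v ∈ c.supp, degN K v = 2 ∨ {u | K.Reachable v u}.ncard = 2) :
    IsCycleComp K c ∨ IsEdgeComp K c := by
  by_cases hc : ∃ v ∈ c.supp, {u | K.Reachable v u}.ncard = 2
  · right
    obtain ⟨v, hv, h2⟩ := hc
    unfold IsEdgeComp
    rw [← h2]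
    congr 1
    ext u
    simp only [ConnectedComponent.mem_supp_iff] at *
    subst hv
    simp only [Set.mem_ofPred_eq, ConnectedComponent.eq]
    exact ⟨fun h => h.symm, fun h => h.symm⟩
  · left
    intro v hv
    rcases h v hv with h1 | h1
    · exact h1
    · exact absurd ⟨v, hv, h1⟩ hc

lemma close_up {V : Type*} [Finite V] {H : SimpleGraph V} {x y : V} (h : St H x y) (hne : x ≠ y)
    (hxy : ¬ H.Adj x y) :
    IsLe2Factor (modifyGraph H {s(x, y)} ∅) ∧ SR H (modifyGraph H {s(x, y)} ∅) ∧
    (modifyGraph H {s(x, y)} ∅).edgeSet.ncard = H.edgeSet.ncard + 1 := by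
  set K := modifyGraph H {s(x, y)} ∅ with hK
  have sr : SR H K := by
    intro a b
    constructor
    · apply Reachable.mono
      intro a b hab
      rw [hK, mod_adj]
      exact ⟨⟨Or.inl hab, by simp⟩, hab.ne⟩
    · apply reach_of_adj
      intro a b hab
      rw [hK, mod_adj] at hab
      rcases hab.1.1 with h1 | h1
      · exact h1.reachable
      · rw [Set.mem_singleton_iff, Sym2.eq_iff] at h1
        rcases h1 with ⟨rfl, rfl⟩ | ⟨rfl, rfl⟩
        · exact h.reach
        · exact h.reach.symm
  refine ⟨fun c => le2_of c fun v _ => ?_, sr, edges_add H hne hxy⟩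
  rw [← sr.ncard, degN_add H hne hxy]
  by_cases hv : H.Reachable x v
  · left; exact h.deg v hv
  · rw [ind_ne (by rintro rfl; exact hv (.refl _)), ind_ne (by rintro rfl; exact hv h.reach)]
    exact h.out v hv

lemma degN_of_comp2 {V : Type*} [Finite V] {H : SimpleGraph V} {w : V}
    (h : {u | H.Reachable w u}.ncard = 2) :
    ∃ z, H.Adj w z ∧ {u | H.Reachable w u} = {w, z} ∧ degN H w = 1 ∧ degN H z = 1 := by
  have hw : w ∈ {u | H.Reachable w u} := Reachable.refl w
  obtain ⟨a, b, hab, hs⟩ := Set.ncard_eq_two.1 h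
  obtain ⟨z, hz, hs⟩ : ∃ z, z ≠ w ∧ {u | H.Reachable w u} = {w, z} := by
    rw [hs] at hw
    rcases hw with rfl | rfl
    · exact ⟨b, hab.symm, hs⟩
    · exact ⟨a, hab, by rw [hs, Set.pair_comm]⟩
  have hmem : ∀ u, H.Reachable w u ↔ u = w ∨ u = z := fun u => by
    have := Set.ext_iff.1 hs u
    simpa using this
  have hwz : H.Reachable w z := (hmem z).2 (Or.inr rfl)
  have hadj : H.Adj w z := by
    obtain ⟨p⟩ := hwz
    cases p with
    | nil => exact absurd rfl hz
    | cons h' q =>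
      rcases (hmem _).1 h'.reachable with rfl | rfl
      · exact absurd rfl h'.ne
      · exact h'
  refine ⟨z, hadj, hs, ?_, ?_⟩
  · unfold degN
    rw [Set.ncard_eq_one]
    refine ⟨z, ?_⟩
    ext u
    simp only [mem_neighborSet, Set.mem_singleton_iff]
    constructor
    · intro hu
      rcases (hmem _).1 hu.reachable with rfl | rfl
      · exact absurd rfl hu.ne
      · rfl
    · rintro rfl; exact hadj
  · unfold degN
    rw [Set.ncard_eq_one]
    refine ⟨w, ?_⟩
    ext u
    simp only [mem_neighborSet, Set.mem_singleton_iff]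
    constructor
    · intro hu
      rcases (hmem _).1 (hwz.trans hu.reachable) with rfl | rfl
      · rfl
      · exact absurd rfl hu.ne
    · rintro rfl; exact hadj.symm

lemma St.partialHC {V : Type*} [Finite V] {H : SimpleGraph V} {x y : V} (h : St H x y) :
    IsPartialHC H := by
  refine ⟨fun v => ?_, H.connectedComponentMk x, ⟨x, rfl, ?_⟩, fun c' hc' => ?_⟩
  · by_cases hv : H.Reachable x v
    · have := h.deg v hv; omega
    · rcases h.out v hv with h1 | h1
      · omega
      · obtain ⟨z, -, -, h2, -⟩ := degN_of_comp2 h1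
        omega
  · have := h.deg x (.refl _)
    rw [ind_self] at this
    omega
  · have key : ∀ v ∈ c'.supp, degN H v = 2 ∨ {u | H.Reachable v u}.ncard = 2 := by
      intro v hv
      apply h.out
      intro hx
      apply hc'
      rw [ConnectedComponent.mem_supp_iff] at hv
      rw [← hv]
      exact (ConnectedComponent.eq.2 hx).symm
    exact le2_of c' key

lemma odd_partner {V : Type*} [Finite V] (H : SimpleGraph V) (x : V) (hx : Odd (degN H x)) :
    ∃ y, y ≠ x ∧ H.Reachable x y ∧ Odd (degN H y) := by
  classical
  have := Fintype.ofFinite V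
  let K : SimpleGraph V :=
    { Adj := fun a b => H.Adj a b ∧ H.Reachable x a
      symm := ⟨fun a b h => ⟨h.1.symm, h.2.trans h.1.reachable⟩⟩
      loopless := ⟨fun a h => h.1.ne rfl⟩ }
  have hdeg : ∀ v, K.degree v = (K.neighborSet v).ncard := by
    intro v
    rw [← SimpleGraph.card_neighborSet_eq_degree, Set.ncard_eq_toFinset_card', Set.toFinset_card]
  have h1 : ∀ v, H.Reachable x v → K.degree v = degN H v := by
    intro v hv
    rw [hdeg, degN]
    congr 1
    ext u
    simp [K, hv]
  obtain ⟨y, hy, hy'⟩ := K.exists_ne_odd_degree_of_exists_odd_degree x (by rwa [h1 x (.refl _)])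
  have hr : H.Reachable x y := by
    by_contra hr
    have : K.neighborSet y = ∅ := by
      ext u
      simp [K, hr]
    rw [hdeg, this] at hy'
    simp at hy'
  exact ⟨y, hy, hr, by rwa [h1 y hr] at hy'⟩

lemma merge_numComp {V : Type*} [Finite V] {H K : SimpleGraph V} {x w : V}
    (hw : ¬ H.Reachable x w)
    (hK : ∀ a b, K.Reachable a b ↔ H.Reachable a b ∨ (H.Reachable a x ∧ H.Reachable w b) ∨
      (H.Reachable a w ∧ H.Reachable x b)) : numComp K + 1 = numComp H := by
  unfold numComp
  let f : H.ConnectedComponent → K.ConnectedComponent :=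
    Quot.map id (fun a b h => (hK a b).2 (Or.inl h))
  have hf : ∀ a, f (H.connectedComponentMk a) = K.connectedComponentMk a := fun a => rfl
  have hb : Function.Bijective
      (fun c : ({H.connectedComponentMk w}ᶜ : Set H.ConnectedComponent) => f c.1) := by
    constructor
    · rintro ⟨c, hc⟩ ⟨c', hc'⟩ h
      induction c using ConnectedComponent.ind with | _ a =>
      induction c' using ConnectedComponent.ind with | _ b =>
      simp only [hf, ConnectedComponent.eq] at h
      simp only [Set.mem_compl_iff, Set.mem_singleton_iff, ConnectedComponent.eq] at hc hc'
      rw [hK] at h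
      simp only [Subtype.mk.injEq, ConnectedComponent.eq]
      rcases h with h | h | h
      · exact h
      · exact absurd h.2.symm hc'
      · exact absurd h.1 hc
    · intro c
      induction c using ConnectedComponent.ind with | _ a =>
      by_cases ha : H.Reachable a w
      · refine ⟨⟨H.connectedComponentMk x, ?_⟩, ?_⟩
        · simpa using hw
        · simp only [hf, ConnectedComponent.eq, hK]
          exact Or.inr (Or.inl ⟨.refl _, ha.symm⟩)
      · exact ⟨⟨H.connectedComponentMk a, by simpa using ha⟩, hf a⟩
  have h1 := Nat.card_congr (Equiv.ofBijective _ hb)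
  rw [Nat.card_coe_set_eq] at h1
  have h2 := Set.ncard_add_ncard_compl ({H.connectedComponentMk w} : Set H.ConnectedComponent)
  rw [Set.ncard_singleton] at h2
  omega

lemma SR.partner {V : Type*} {H K : SimpleGraph V} (h : SR H K) : SR K H :=
  fun a b => (h a b).symm

lemma not_bridge {V : Type*} [Finite V] {H : SimpleGraph V} {w z : V} (hwz : H.Adj w z)
    (h2 : ∀ v, H.Reachable w v → degN H v = 2) :
    (modifyGraph H ∅ {s(w, z)}).Reachable w z := by
  set K := modifyGraph H ∅ {s(w, z)} with hK
  have hd := degN_del H hwz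
  rw [← hK] at hd
  have hle : K ≤ H := by
    intro a b hab
    rw [hK, mod_adj] at hab
    simp only [Set.mem_empty_iff_false, or_false] at hab
    tauto
  have hw : degN K w = 1 := by
    have := hd w
    rw [ind_self, ind_ne hwz.ne, h2 w (.refl _)] at this
    omega
  obtain ⟨y, hy, hr, ho⟩ := odd_partner K w (by rw [hw]; decide)
  by_cases hyz : y = z
  · exact hyz ▸ hr
  · have := hd y
    rw [ind_ne hy, ind_ne hyz, h2 y (hr.mono hle)] at this
    rw [show degN K y = 2 by omega] at ho
    exact absurd ho (by decide)

lemma extend_step {V : Type*} [Finite V] {H : SimpleGraph V} {x y w : V} (h : St H x y)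
    (hw : ¬ H.Reachable x w) :
    ∃ z, H.Adj w z ∧ (GoodStep H (modifyGraph H {s(x, w)} {s(w, z)}) ∨
      GoodStep H (modifyGraph H {s(x, w)} ∅)) := by
  have hne : x ≠ w := by rintro rfl; exact hw (.refl _)
  have hna : ¬ H.Adj x w := fun h' => hw h'.reachable
  set K := modifyGraph H {s(x, w)} ∅ with hK
  have hHK : H ≤ K := by
    intro a b hab
    rw [hK, mod_adj]
    exact ⟨⟨Or.inl hab, by simp⟩, hab.ne⟩
  have hKxw : K.Reachable x w := by
    apply Adj.reachable
    rw [hK, mod_adj]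
    exact ⟨⟨Or.inr rfl, by simp⟩, hne⟩
  have hR : ∀ a b, K.Reachable a b ↔ H.Reachable a b ∨ (H.Reachable a x ∧ H.Reachable w b) ∨
      (H.Reachable a w ∧ H.Reachable x b) := by
    intro a b
    constructor
    · rintro ⟨p⟩
      induction p with
      | nil => exact Or.inl (.refl _)
      | @cons a c b hac p ih =>
        rw [hK, mod_adj] at hac
        rcases hac.1.1 with h1 | h1
        · have := h1.reachable
          rcases ih with h2 | h2 | h2
          · exact Or.inl (this.trans h2)
          · exact Or.inr (Or.inl ⟨this.trans h2.1, h2.2⟩)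
          · exact Or.inr (Or.inr ⟨this.trans h2.1, h2.2⟩)
        · rw [Set.mem_singleton_iff, Sym2.eq_iff] at h1
          rcases h1 with ⟨rfl, rfl⟩ | ⟨rfl, rfl⟩
          · rcases ih with h2 | h2 | h2
            · exact Or.inr (Or.inl ⟨.refl _, h2⟩)
            · exact Or.inr (Or.inl ⟨.refl _, h2.2⟩)
            · exact Or.inl h2.2
          · rcases ih with h2 | h2 | h2
            · exact Or.inr (Or.inr ⟨.refl _, h2⟩)
            · exact Or.inl h2.2
            · exact absurd h2.1 hw
    · rintro (h1 | h1 | h1)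
      · exact h1.mono hHK
      · exact (h1.1.mono hHK).trans (hKxw.trans (h1.2.mono hHK))
      · exact (h1.1.mono hHK).trans (hKxw.symm.trans (h1.2.mono hHK))
  have hnum := merge_numComp hw hR
  have hwx : ¬ H.Reachable w x := fun h' => hw h'.symm
  have hwy : ¬ H.Reachable w y := fun h' => hw (h.reach.trans h'.symm)
  have hset : ∀ v, ¬ K.Reachable w v → {u | K.Reachable v u} = {u | H.Reachable v u} := by
    intro v hv
    ext u
    constructor
    · intro hu
      have hu' : K.Reachable v u := hu
      rw [hR] at hu'
      rcases hu' with h1 | h1 | h1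
      · exact h1
      · exact absurd (hKxw.symm.trans (h1.1.mono hHK).symm) hv
      · exact absurd (h1.1.mono hHK).symm hv
    · intro hu
      exact Reachable.mono hHK hu
  by_cases hc : {u | H.Reachable w u}.ncard = 2
  · obtain ⟨z, hwz, hs, hdw, hdz⟩ := degN_of_comp2 hc
    refine ⟨z, hwz, Or.inr ⟨St.partialHC (x := z) (y := y) ?_, hnum, ?_⟩⟩
    · have hzw : K.Reachable z w := hwz.symm.reachable.mono hHK
      refine ⟨hzw.trans (hKxw.symm.trans (h.reach.mono hHK)), fun v hv => ?_, fun v hv => ?_⟩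
      · rw [hR] at hv
        rw [degN_add H hne hna]
        have h3 : H.Reachable x v ∨ H.Reachable w v := by
          rcases hv with h1 | h1 | h1
          · exact Or.inr (hwz.reachable.trans h1)
          · exact Or.inr h1.2
          · exact Or.inl h1.2
        rcases h3 with h3 | h3
        · rw [ind_ne (a := v) (b := w) (by rintro rfl; exact hw h3),
            ind_ne (a := v) (b := z) (by rintro rfl; exact hw (h3.trans hwz.symm.reachable))]
          have := h.deg v h3
          omega
        · rw [ind_ne (a := v) (b := x) (by rintro rfl; exact hwx h3),
            ind_ne (a := v) (b := y) (by rintro rfl; exact hwy h3)]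
          have : v ∈ ({w, z} : Set V) := hs ▸ h3
          rcases this with rfl | h4
          · rw [ind_self, ind_ne hwz.ne, hdw]
          · rw [Set.mem_singleton_iff] at h4
            subst h4
            rw [ind_self, ind_ne hwz.ne.symm, hdz]
      · have hv' : ¬ K.Reachable w v := fun h' => hv (hzw.trans h')
        rw [hset v hv', degN_add H hne hna, ind_ne (by rintro rfl; exact hv' hKxw.symm),
          ind_ne (by rintro rfl; exact hv' (.refl _))]
        exact h.out v (fun h' => hv' (hKxw.symm.trans (h'.mono hHK)))
    · rw [edges_add H hne hna]; omega
  · have hdeg2 : ∀ v, H.Reachable w v → degN H v = 2 := by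
      intro v hv
      rcases h.out v (fun h' => hw (h'.trans hv.symm)) with h1 | h1
      · exact h1
      · exfalso
        apply hc
        rw [← h1]
        congr 1
        ext u
        exact ⟨fun h' => hv.symm.trans h', fun h' => hv.trans h'⟩
    obtain ⟨z, hwz⟩ : ∃ z, H.Adj w z := by
      have := hdeg2 w (.refl _)
      by_contra hcon
      push Not at hcon
      have h0 : H.neighborSet w = ∅ := by
        ext u; simp [hcon u]
      rw [degN, h0] at this
      simp at this
    have hbr := not_bridge hwz hdeg2
    set K' := modifyGraph H {s(x, w)} {s(w, z)} with hK'
    have hle1 : modifyGraph H ∅ {s(w, z)} ≤ K' := by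
      intro a b hab
      rw [mod_adj] at *
      simp only [Set.mem_empty_iff_false, or_false] at hab
      tauto
    have sr : SR K K' := by
      intro a b
      constructor
      · apply reach_of_adj
        intro a b hab
        by_cases hh : s(a, b) = s(w, z)
        · rw [Sym2.eq_iff] at hh
          rcases hh with ⟨rfl, rfl⟩ | ⟨rfl, rfl⟩
          · exact hbr.mono hle1
          · exact (hbr.mono hle1).symm
        · apply Adj.reachable
          rw [hK, mod_adj] at hab
          rw [hK', mod_adj]
          exact ⟨⟨hab.1.1, hh⟩, hab.2⟩
      · apply Reachable.mono
        intro a b hab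
        rw [hK', mod_adj] at hab
        rw [hK, mod_adj]
        exact ⟨⟨hab.1.1, by simp⟩, hab.2⟩
    have hd := degN_swap H hne hna hwz
    rw [← hK'] at hd
    refine ⟨z, hwz, Or.inl ⟨St.partialHC (x := z) (y := y) ?_, by rw [← sr.numComp]; exact hnum, ?_⟩⟩
    · have hzw : K.Reachable z w := hwz.symm.reachable.mono hHK
      refine ⟨(sr _ _).1 (hzw.trans (hKxw.symm.trans (h.reach.mono hHK))),
        fun v hv => ?_, fun v hv => ?_⟩
      · rw [← sr, hR] at hv
        have hdv := hd v
        change degN K' v + ind v z + ind v y = 2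
        have h3 : H.Reachable x v ∨ H.Reachable w v := by
          rcases hv with h1 | h1 | h1
          · exact Or.inr (hwz.reachable.trans h1)
          · exact Or.inr h1.2
          · exact Or.inl h1.2
        rcases h3 with h3 | h3
        · have := h.deg v h3
          omega
        · rw [ind_ne (a := v) (b := x) (by rintro rfl; exact hwx h3)] at hdv
          rw [ind_ne (a := v) (b := y) (by rintro rfl; exact hwy h3)]
          have := hdeg2 v h3
          omega
      · have hv' : ¬ K.Reachable w v := fun h' => hv ((sr _ _).1 (hzw.trans h'))
        have hdv := hd v
        rw [ind_ne (a := v) (b := x) (by rintro rfl; exact hv' hKxw.symm),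
          ind_ne (a := v) (b := w) (by rintro rfl; exact hv' (.refl _)),
          ind_ne (a := v) (b := z) (by rintro rfl; exact hv' hzw.symm)] at hdv
        rw [← sr.ncard, hset v hv']
        have := h.out v (fun h' => hv' (hKxw.symm.trans (h'.mono hHK)))
        simp only [add_zero] at hdv
        rwa [hdv]
    · rw [edges_swap H hne hna hwz]

structure PV {V : Type*} (H : SimpleGraph V) (x y : V) (k : ℕ) (v : ℕ → V) : Prop where
  h0 : v 0 = x
  hk : v k = y
  inj : ∀ a ≤ k, ∀ b ≤ k, v a = v b → a = b
  adj : ∀ t < k, H.Adj (v t) (v (t + 1))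
  adj' : ∀ a ≤ k, ∀ w, H.Adj (v a) w → ∃ b ≤ k, w = v b ∧ (b = a + 1 ∨ a = b + 1)
  cover : ∀ w, H.Reachable x w → ∃ a ≤ k, w = v a

lemma two_nbrs {V : Type*} [Finite V] {H : SimpleGraph V} {a b c : V} (hb : H.Adj a b)
    (hc : H.Adj a c) (hbc : b ≠ c) (hd : degN H a ≤ 2) : H.neighborSet a = {b, c} := by
  symm
  apply Set.eq_of_subset_of_ncard_le
  · rintro u (rfl | rfl)
    · exact hb
    · exact hc
  · rw [Set.ncard_pair hbc]; exact hd
  · exact Set.toFinite _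

lemma one_nbr {V : Type*} [Finite V] {H : SimpleGraph V} {a b : V} (hb : H.Adj a b)
    (hd : degN H a ≤ 1) : H.neighborSet a = {b} := by
  symm
  apply Set.eq_of_subset_of_ncard_le
  · rintro u rfl
    exact hb
  · rw [Set.ncard_singleton]; exact hd
  · exact Set.toFinite _

lemma exists_PV {V : Type*} [Finite V] {H : SimpleGraph V} {x y : V} (hxy : x ≠ y)
    (hr : H.Reachable x y) (h2 : ∀ v, H.Reachable x v → degN H v ≤ 2) (hx : degN H x ≤ 1)
    (hy : degN H y ≤ 1) :
    ∃ k v, PV H x y k v := by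
  classical
  obtain ⟨p, hp⟩ := hr.exists_isPath
  have hl : 0 < p.length := by
    rcases Nat.eq_zero_or_pos p.length with h | h
    · exact absurd (SimpleGraph.Walk.eq_of_length_eq_zero h) hxy
    · exact h
  have inj : ∀ a ≤ p.length, ∀ b ≤ p.length, p.getVert a = p.getVert b → a = b := by
    intro a ha b hb h
    exact hp.getVert_injOn ha hb h
  have adj : ∀ t < p.length, H.Adj (p.getVert t) (p.getVert (t + 1)) := by
    intro t ht
    exact p.adj_getVert_succ ht
  have hreach : ∀ t, H.Reachable x (p.getVert t) := fun t => ⟨p.take t⟩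
  have adj' : ∀ a ≤ p.length, ∀ w, H.Adj (p.getVert a) w →
      ∃ b ≤ p.length, w = p.getVert b ∧ (b = a + 1 ∨ a = b + 1) := by
    intro a ha w hw
    have hw' : w ∈ H.neighborSet (p.getVert a) := hw
    rcases Nat.eq_zero_or_pos a with rfl | ha0
    · rw [one_nbr (adj 0 hl) (by simpa using hx)] at hw'
      exact ⟨1, hl, by simpa using hw', Or.inl rfl⟩
    · have hpred : H.Adj (p.getVert a) (p.getVert (a - 1)) := by
        have := adj (a - 1) (by omega)
        rw [show a - 1 + 1 = a by omega] at this
        exact this.symm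
      rcases Nat.lt_or_ge a p.length with h | h
      · rw [two_nbrs hpred (adj a h) (fun h' => by
          have := inj _ (by omega) _ (by omega) h'; omega) (h2 _ (hreach a))] at hw'
        rcases hw' with h3 | h3
        · exact ⟨a - 1, by omega, h3, by omega⟩
        · exact ⟨a + 1, by omega, h3, by omega⟩
      · have : a = p.length := by omega
        subst this
        rw [one_nbr hpred (by simpa using hy)] at hw'
        exact ⟨p.length - 1, by omega, hw', by omega⟩
  refine ⟨p.length, p.getVert, by simp, by simp, inj, adj, adj', ?_⟩
  have key : ∀ a b, H.Reachable a b → (∃ i ≤ p.length, a = p.getVert i) →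
      ∃ i ≤ p.length, b = p.getVert i := by
    rintro a b ⟨q⟩
    induction q with
    | nil => exact id
    | cons h q ih =>
      rintro ⟨i, hi, rfl⟩
      obtain ⟨b, hb, h3, -⟩ := adj' i hi _ h
      exact ih ⟨b, hb, h3⟩
  intro w hw
  exact key x w hw ⟨0, by omega, by simp⟩

lemma PV.deg {V : Type*} [Finite V] {H : SimpleGraph V} {x y : V} {k : ℕ} {v : ℕ → V}
    (h : PV H x y k v) {a : ℕ} (h1 : 0 < a) (h2 : a < k) : 2 ≤ degN H (v a) := by
  have e1 := h.adj a h2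
  have e2 := h.adj (a - 1) (by omega)
  rw [show a - 1 + 1 = a by omega] at e2
  have hne : v (a - 1) ≠ v (a + 1) := fun h' => by
    have := h.inj _ (by omega) _ (by omega) h'
    omega
  rw [← Set.ncard_pair hne]
  apply Set.ncard_le_ncard _ (Set.toFinite _)
  rintro u (rfl | rfl)
  · exact e2.symm
  · exact e1

lemma exists_St {V : Type*} [Finite V] {H : SimpleGraph V} (h : IsPartialHC H) :
    ∃ x y, St H x y := by
  obtain ⟨hd, c, ⟨x, hxc, hx⟩, hc⟩ := h
  have hout : ∀ v, ¬ H.Reachable x v → degN H v = 2 ∨ {u | H.Reachable v u}.ncard = 2 := by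
    intro v hv
    have hne : H.connectedComponentMk v ≠ c := by
      intro h'
      rw [ConnectedComponent.mem_supp_iff] at hxc
      rw [← hxc, ConnectedComponent.eq] at h'
      exact hv h'.symm
    rcases hc _ hne with h1 | h1
    · exact Or.inl (h1 v rfl)
    · right
      rw [← h1]
      congr 1
      ext u
      simp only [ConnectedComponent.mem_supp_iff, ConnectedComponent.eq]
      exact ⟨fun h => h.symm, fun h => h.symm⟩
  rcases Nat.eq_zero_or_pos (degN H x) with h0 | h0
  · refine ⟨x, x, .refl _, fun v hv => ?_, hout⟩
    have : v = x := by
      obtain ⟨p⟩ := hv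
      cases p with
      | nil => rfl
      | cons h' q =>
        exfalso
        rw [degN, Set.ncard_eq_zero (Set.toFinite _)] at h0
        have : _ ∈ H.neighborSet x := h'
        rw [h0] at this
        exact this
    subst this
    rw [ind_self, h0]
  · have hx1 : degN H x = 1 := by omega
    obtain ⟨y, hyx, hr, ho⟩ := odd_partner H x (by rw [hx1]; decide)
    have hy1 : degN H y = 1 := by
      have := hd y
      interval_cases hh : degN H y
      · exact absurd ho (by decide)
      · rfl
      · exact absurd ho (by decide)
    obtain ⟨k, v, pv⟩ := exists_PV hyx.symm hr (fun v _ => hd v) hx hy1.le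
    refine ⟨x, y, hr, fun u hu => ?_, hout⟩
    obtain ⟨a, ha, rfl⟩ := pv.cover u hu
    by_cases h1 : v a = x
    · rw [h1, ind_self, ind_ne hyx.symm, hx1]
    · by_cases h2 : v a = y
      · rw [h2, ind_self, ind_ne hyx, hy1]
      · rw [ind_ne h1, ind_ne h2]
        have h3 : 0 < a := by
          rcases Nat.eq_zero_or_pos a with rfl | h
          · exact absurd pv.h0 h1
          · exact h
        have h4 : a < k := by
          rcases ha.lt_or_eq with h | rfl
          · exact h
          · exact absurd pv.hk h2
        have := pv.deg h3 h4
        have := hd (v a)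
        omega

def C1 {V : Type*} (G F H : SimpleGraph V) : Prop :=
  ∃ e ∈ (G ⊔ F).edgeSet \ H.edgeSet, ∃ e₁ ∈ (G ⊔ F).edgeSet \ H.edgeSet,
    ∃ e₂ ∈ (G ⊔ F).edgeSet \ H.edgeSet, ∃ e' ∈ H.edgeSet, ∃ e₁' ∈ H.edgeSet,
    ∃ e₂' ∈ H.edgeSet,
      GoodStep H (modifyGraph H {e} {e'}) ∨
      GoodStep H (modifyGraph H {e} ∅) ∨
      GoodStep H (modifyGraph H {e, e₁, e₂} {e', e₁', e₂'}) ∨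
      GoodStep H (modifyGraph H {e, e₁, e₂} {e₁', e₂'})

def C2 {V : Type*} (G F H : SimpleGraph V) : Prop :=
  ∃ e₁ ∈ (G ⊔ F).edgeSet \ H.edgeSet, ∃ e₂ ∈ (G ⊔ F).edgeSet \ H.edgeSet,
    ∃ e₃ ∈ (G ⊔ F).edgeSet \ H.edgeSet, ∃ e₁' ∈ H.edgeSet, ∃ e₂' ∈ H.edgeSet,
    ∃ e₃' ∈ H.edgeSet, ∃ f ∈ F.edgeSet \ H.edgeSet,
      IsLe2Factor (modifyGraph H {e₁, e₂, e₃, f} {e₁', e₂', e₃'}) ∧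
      modifyGraph H {e₁, e₂, e₃, f} {e₁', e₂', e₃'} ≤ G ⊔ F ∧
      numComp (modifyGraph H {e₁, e₂, e₃, f} {e₁', e₂', e₃'}) = numComp H ∧
      (modifyGraph H {e₁, e₂, e₃, f} {e₁', e₂', e₃'}).edgeSet.ncard =
        H.edgeSet.ncard + 1

lemma ext_base {V : Type*} [Finite V] {G F H : SimpleGraph V} {x y w : V} (h : St H x y)
    (hw : ¬ H.Reachable x w) (hxw : (G ⊔ F).Adj x w) : C1 G F H := by
  obtain ⟨z, hwz, hg⟩ := extend_step h hw
  have he : s(x, w) ∈ (G ⊔ F).edgeSet \ H.edgeSet :=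
    ⟨hxw, fun h' => hw (Adj.reachable h')⟩
  refine ⟨_, he, _, he, _, he, s(w, z), hwz, s(w, z), hwz, s(w, z), hwz, ?_⟩
  rcases hg with hg | hg
  · exact Or.inl hg
  · exact Or.inr (Or.inl hg)

/-- `K` is obtained from `H` by two rotations using edges of `G`. -/
structure R2 {V : Type*} (G F H K : SimpleGraph V) (p q : V) (e₁ e₂ e₁' e₂' : Sym2 V) :
    Prop where
  st : St K p q
  sr : SR H K
  ec : K.edgeSet.ncard = H.edgeSet.ncard
  eq : K = modifyGraph H {e₁, e₂} {e₁', e₂'}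
  g1 : e₁ ∈ G.edgeSet
  g2 : e₂ ∈ G.edgeSet
  n1 : e₁ ∉ H.edgeSet
  n2 : e₂ ∉ H.edgeSet
  h1 : e₁' ∈ H.edgeSet
  h2 : e₂' ∈ H.edgeSet

lemma R2.symm {V : Type*} {G F H K : SimpleGraph V} {p q : V} {e₁ e₂ e₁' e₂' : Sym2 V}
    (r : R2 G F H K p q e₁ e₂ e₁' e₂') : R2 G F H K q p e₁ e₂ e₁' e₂' :=
  { r with st := r.st.symm }

lemma ext_final {V : Type*} [Finite V] {G F H K : SimpleGraph V} {p q : V}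
    {e₁ e₂ e₁' e₂' : Sym2 V}
    (r : R2 G F H K p q e₁ e₂ e₁' e₂') {w : V} (hw : ¬ H.Reachable p w)
    (hpw : (G ⊔ F).Adj p w) (hw1 : w ∉ e₁) (hw2 : w ∉ e₂) : C1 G F H := by
  obtain ⟨z, hwz, hg⟩ := extend_step r.st (fun h' => hw ((r.sr _ _).2 h'))
  have he : s(p, w) ∉ H.edgeSet := fun h' => hw (Adj.reachable h')
  have hle : G.edgeSet ⊆ (G ⊔ F).edgeSet := SimpleGraph.edgeSet_mono le_sup_left
  have hwz' : s(w, z) ∈ H.edgeSet := by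
    rw [r.eq, mod_adj] at hwz
    rcases hwz.1.1 with h1 | h1 | h1
    · exact h1
    · exact absurd (h1 ▸ Sym2.mem_mk_left w z) hw1
    · exact absurd (h1 ▸ Sym2.mem_mk_left w z) hw2
  have hG : ∀ K', GoodStep K K' → GoodStep H K' := by
    rintro K' ⟨h1, h2, h3⟩
    exact ⟨h1, by rw [h2, r.sr.numComp], r.ec ▸ h3⟩
  refine ⟨_, ⟨hpw, he⟩, _, ⟨hle r.g1, r.n1⟩, _, ⟨hle r.g2, r.n2⟩, _, hwz', _, r.h1, _, r.h2, ?_⟩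
  have hD : ∀ e ∈ ({s(p, w)} : Set (Sym2 V)), e ∉ ({e₁', e₂'} : Set (Sym2 V)) := by
    rintro e rfl (h1 | h1)
    · exact he (h1 ▸ r.h1)
    · exact he (h1 ▸ r.h2)
  rcases hg with hg | hg
  · right; right; left
    have := hG _ hg
    rw [r.eq, mod_mod _ _ _ _ _ hD] at this
    convert this using 2
    · ext e; simp <;> tauto
    · ext e; simp <;> tauto
  · right; right; right
    have := hG _ hg
    rw [r.eq, mod_mod _ _ _ _ _ hD] at this
    convert this using 2
    · ext e; simp <;> tauto
    · simp

lemma final_step {V : Type*} [Finite V] {G F H K : SimpleGraph V} {p q : V}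
    {e₁ e₂ e₁' e₂' : Sym2 V} (hGF : Disjoint G F) (hH : H ≤ G ⊔ F)
    (r : R2 G F H K p q e₁ e₂ e₁' e₂') {s t : V} (hst : H.Adj s t)
    (d1 : s(s, t) ≠ e₁') (d2 : s(s, t) ≠ e₂') (hps : F.Adj p s) (htq : F.Adj t q)
    (hps' : ¬ H.Adj p s) (htq' : ¬ H.Adj t q) (htp : t ≠ p)
    (hr : (modifyGraph H {e₁, e₂} {e₁', e₂', s(s, t)}).Reachable p t) : C2 G F H := by
  have hle : G.edgeSet ⊆ (G ⊔ F).edgeSet := SimpleGraph.edgeSet_mono le_sup_left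
  have hleF : F.edgeSet ⊆ (G ⊔ F).edgeSet := SimpleGraph.edgeSet_mono le_sup_right
  have hdis : ∀ e ∈ F.edgeSet, e ∉ G.edgeSet := by
    intro e he he'
    exact Set.disjoint_left.1 (SimpleGraph.disjoint_edgeSet.2 hGF) he' he
  have hFe : ∀ a b, F.Adj a b → s(a, b) ≠ e₁ ∧ s(a, b) ≠ e₂ := by
    intro a b hab
    constructor
    · intro h; exact hdis s(a, b) hab (h ▸ r.g1)
    · intro h; exact hdis s(a, b) hab (h ▸ r.g2)
  have hKst : K.Adj s t := by
    rw [r.eq, mod_adj]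
    refine ⟨⟨Or.inl hst, ?_⟩, hst.ne⟩
    rintro (h | h)
    · exact d1 h
    · exact d2 h
  have hKF : ∀ a b, F.Adj a b → ¬ H.Adj a b → ¬ K.Adj a b := by
    intro a b hab hn h
    rw [r.eq, mod_adj] at h
    rcases h.1.1 with h | h | h
    · exact hn h
    · exact (hFe a b hab).1 h
    · exact (hFe a b hab).2 h
  obtain ⟨st3, sr3, ec3⟩ := rotate r.st hKst (hKF _ _ hps hps') hps.ne (by
    rw [r.eq, mod_mod _ _ _ _ _ (by simp)]
    convert hr using 2
    · simp
    · ext e; simp <;> tauto)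
  have hn3 : ¬ (modifyGraph K {s(p, s)} {s(s, t)}).Adj t q := by
    intro h
    rw [mod_adj] at h
    rcases h.1.1 with h | h
    · exact hKF _ _ htq htq' h
    · rw [Set.mem_singleton_iff, Sym2.eq_iff] at h
      rcases h with h | h
      · exact htp h.1
      · exact hst.ne h.1.symm
  obtain ⟨fac, sr4, ec4⟩ := close_up st3 htq.ne hn3
  have heq : modifyGraph (modifyGraph K {s(p, s)} {s(s, t)}) {s(t, q)} ∅ =
      modifyGraph H {e₁, e₂, s(p, s), s(t, q)} {e₁', e₂', s(s, t)} := by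
    rw [r.eq, mod_mod _ _ _ {s(p, s)}, mod_mod]
    · congr 1
      · ext e; simp <;> tauto
      · ext e; simp <;> tauto
    · rintro e rfl ((h | h) | h)
      · exact htq' (show s(t, q) ∈ H.edgeSet from h ▸ r.h1)
      · exact htq' (show s(t, q) ∈ H.edgeSet from h ▸ r.h2)
      · exact htq' (show s(t, q) ∈ H.edgeSet from h ▸ hst)
    · rintro e rfl (h | h)
      · exact hps' (show s(p, s) ∈ H.edgeSet from h ▸ r.h1)
      · exact hps' (show s(p, s) ∈ H.edgeSet from h ▸ r.h2)
  rw [heq] at fac sr4 ec4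
  refine ⟨e₁, ⟨hle r.g1, r.n1⟩, e₂, ⟨hle r.g2, r.n2⟩, s(p, s), ⟨hleF hps, hps'⟩,
    e₁', r.h1, e₂', r.h2, s(s, t), hst, s(t, q), ⟨htq, htq'⟩, fac, ?_, ?_, ?_⟩
  · intro a b hab
    rw [mod_adj] at hab
    rcases hab.1.1 with h | h | h | h | h
    · exact hH h
    · exact hle (show s(a, b) ∈ G.edgeSet from h ▸ r.g1)
    · exact hle (show s(a, b) ∈ G.edgeSet from h ▸ r.g2)
    · exact hleF (show s(a, b) ∈ F.edgeSet from h ▸ hps)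
    · exact hleF (show s(a, b) ∈ F.edgeSet from h ▸ htq)
  · rw [← sr4.numComp, ← sr3.numComp, r.sr.numComp]
  · rw [ec4, ec3, r.ec]

section paths

variable {V : Type*} {H : SimpleGraph V} {x y : V} {k : ℕ} {v : ℕ → V}

lemma PV.sym (h : PV H x y k v) {a b c d : ℕ} (ha : a ≤ k) (hb : b ≤ k) (hc : c ≤ k)
    (hd : d ≤ k) (he : s(v a, v b) = s(v c, v d)) : (a = c ∧ b = d) ∨ (a = d ∧ b = c) := by
  rw [Sym2.eq_iff] at he
  rcases he with he | he
  · exact Or.inl ⟨h.inj _ ha _ hc he.1, h.inj _ hb _ hd he.2⟩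
  · exact Or.inr ⟨h.inj _ ha _ hd he.1, h.inj _ hb _ hc he.2⟩

lemma PV.nadj (h : PV H x y k v) {a b : ℕ} (ha : a ≤ k) (hb : b ≤ k)
    (hab : H.Adj (v a) (v b)) : b = a + 1 ∨ a = b + 1 := by
  obtain ⟨c, hc, h1, h2⟩ := h.adj' a ha _ hab
  have := h.inj _ hb _ hc h1
  omega

lemma PV.yadj (h : PV H x y k v) {a b : ℕ} (ha : a ≤ k) (hb : b ≤ k)
    (hab : b = a + 1 ∨ a = b + 1) : H.Adj (v a) (v b) := by
  rcases hab with rfl | rfl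
  · exact h.adj a (by omega)
  · exact (h.adj b (by omega)).symm

lemma PV.seg (h : PV H x y k v) (A D : Set (Sym2 V)) {a b : ℕ} (hab : a ≤ b) (hb : b ≤ k)
    (hD : ∀ t, a ≤ t → t < b → s(v t, v (t + 1)) ∉ D) :
    (modifyGraph H A D).Reachable (v a) (v b) := by
  induction b, hab using Nat.le_induction with
  | base => exact .refl _
  | succ b hab ih =>
    refine (ih (by omega) fun t h1 h2 => hD t h1 (by omega)).trans (Adj.reachable ?_)
    rw [mod_adj]
    have := h.adj b (by omega)
    exact ⟨⟨Or.inl this, hD b hab (by omega)⟩, this.ne⟩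

end paths

lemma rot2 {V : Type*} [Finite V] {G F H : SimpleGraph V} {x y : V} {k : ℕ} {v : ℕ → V}
    (pv : PV H x y k v) (st : St H (v 0) (v k)) {i l q : ℕ} (hi : 2 ≤ i) (hi' : i + 2 ≤ k)
    (hl : 2 ≤ l) (hl' : l + 2 ≤ k) (hc : (i < l ∧ q = l + 1) ∨ (l < i ∧ q + 1 = l))
    (hgi : G.Adj (v 0) (v i)) (hgl : G.Adj (v k) (v l)) :
    R2 G F H (modifyGraph H {s(v 0, v i), s(v k, v l)} {s(v i, v (i - 1)), s(v l, v q)})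
      (v (i - 1)) (v q) s(v 0, v i) s(v k, v l) s(v i, v (i - 1)) s(v l, v q) := by
  have n1 : ¬ H.Adj (v 0) (v i) := by
    intro h
    have := pv.nadj (by omega) (by omega) h
    omega
  have n2 : ¬ H.Adj (v k) (v l) := by
    intro h
    have := pv.nadj (by omega) (by omega) h
    omega
  have h1 : H.Adj (v i) (v (i - 1)) := pv.yadj (by omega) (by omega) (by omega)
  have h2 : H.Adj (v l) (v q) := pv.yadj (by omega) (by omega) (by omega)
  obtain ⟨st1, sr1, ec1⟩ := rotate st h1 n1 hgi.ne (by
    apply pv.seg _ _ (by omega) (by omega)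
    rintro t ht ht' h
    have := pv.sym (by omega) (by omega) (by omega) (by omega) h
    omega)
  have he : modifyGraph (modifyGraph H {s(v 0, v i)} {s(v i, v (i - 1))})
      {s(v k, v l)} {s(v l, v q)} =
      modifyGraph H {s(v 0, v i), s(v k, v l)} {s(v i, v (i - 1)), s(v l, v q)} := by
    rw [mod_mod]
    · rfl
    · rintro e rfl h
      have := pv.sym (by omega) (by omega) (by omega) (by omega) h
      omega
  have k2 : (modifyGraph H {s(v 0, v i)} {s(v i, v (i - 1))}).Adj (v l) (v q) := by
    rw [mod_adj]
    refine ⟨⟨Or.inl h2, ?_⟩, h2.ne⟩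
    intro h
    have := pv.sym (by omega) (by omega) (by omega) (by omega) h
    omega
  have m2 : ¬ (modifyGraph H {s(v 0, v i)} {s(v i, v (i - 1))}).Adj (v k) (v l) := by
    rw [mod_adj]
    rintro ⟨⟨h | h, -⟩, -⟩
    · exact n2 h
    · have := pv.sym (by omega) (by omega) (by omega) (by omega) h
      omega
  obtain ⟨st2, sr2, ec2⟩ := rotate st1.symm k2 m2 hgl.ne (by
    rw [mod_mod _ _ _ _ _ (by simp)]
    rcases hc with ⟨hc, rfl⟩ | ⟨hc, rfl⟩
    · apply Reachable.symm
      apply pv.seg _ _ (by omega) (by omega)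
      rintro t ht ht' (h | h)
      · have := pv.sym (by omega) (by omega) (by omega) (by omega) h
        omega
      · have := pv.sym (by omega) (by omega) (by omega) (by omega) h
        omega
    · have r1 : (modifyGraph H ({s(v 0, v i)} ∪ ∅)
          ({s(v i, v (i - 1))} ∪ {s(v (q + 1), v q)})).Reachable (v i) (v k) := by
        apply pv.seg _ _ (by omega) (by omega)
        rintro t ht ht' (h | h)
        · have := pv.sym (by omega) (by omega) (by omega) (by omega) h
          omega
        · have := pv.sym (by omega) (by omega) (by omega) (by omega) h
          omega
      have r2 : (modifyGraph H ({s(v 0, v i)} ∪ ∅)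
          ({s(v i, v (i - 1))} ∪ {s(v (q + 1), v q)})).Reachable (v 0) (v q) := by
        apply pv.seg _ _ (by omega) (by omega)
        rintro t ht ht' (h | h)
        · have := pv.sym (by omega) (by omega) (by omega) (by omega) h
          omega
        · have := pv.sym (by omega) (by omega) (by omega) (by omega) h
          omega
      refine r1.symm.trans (Reachable.trans (Adj.reachable ?_) r2)
      rw [mod_adj]
      refine ⟨⟨Or.inr (Or.inl Sym2.eq_swap), ?_⟩, hgi.ne.symm⟩
      rintro (h | h)
      · have := pv.sym (by omega) (by omega) (by omega) (by omega) h
        omega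
      · have := pv.sym (by omega) (by omega) (by omega) (by omega) h
        omega)
  rw [he] at st2 sr2 ec2
  exact ⟨st2.symm, fun a b => (sr1 a b).trans (sr2 a b), ec2.trans ec1, rfl, hgi, hgl, n1, n2,
    h1, h2⟩

lemma end_game {V : Type*} [Finite V] {G F H : SimpleGraph V} {x y : V} {k : ℕ} {v : ℕ → V}
    (hGF : Disjoint G F) (hH : H ≤ G ⊔ F)
    (pv : PV H x y k v) (st : St H (v 0) (v k)) {i l q s t : ℕ} (hi : 2 ≤ i) (hi' : i + 2 ≤ k)
    (hl : 2 ≤ l) (hl' : l + 2 ≤ k) (hc : (i < l ∧ q = l + 1) ∨ (l < i ∧ q + 1 = l))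
    (hgi : G.Adj (v 0) (v i)) (hgl : G.Adj (v k) (v l))
    (hs : s ≤ k) (ht : t ≤ k) (hti : t + 4 ≤ i ∨ i + 4 ≤ t) (htl : t + 4 ≤ l ∨ l + 4 ≤ t)
    (hst : (i < l ∧ t < i ∧ s + 1 = t) ∨ (i < l ∧ i < t ∧ t < l ∧ s = t + 1) ∨
      (i < l ∧ l < t ∧ s + 1 = t) ∨ (l < i ∧ t < l ∧ s = t + 1) ∨ (l < i ∧ l < t ∧ s + 1 = t))
    (hps : F.Adj (v (i - 1)) (v s)) (htq : F.Adj (v q) (v t)) : C2 G F H := by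
  have r := rot2 (F := F) pv st hi hi' hl hl' hc hgi hgl
  refine final_step hGF hH r (s := v s) (t := v t) ?_ ?_ ?_ hps htq.symm ?_ ?_ ?_ ?_
  · exact pv.yadj (by omega) (by omega) (by omega)
  · intro h
    have := pv.sym (by omega) (by omega) (by omega) (by omega) h
    omega
  · intro h
    have := pv.sym (by omega) (by omega) (by omega) (by omega) h
    omega
  · intro h
    have := pv.nadj (by omega) (by omega) h
    omega
  · intro h
    have := pv.nadj (by omega) (by omega) h
    omega
  · intro h
    have := pv.inj _ (by omega) _ (by omega) h
    omega
  · set K := modifyGraph H {s(v 0, v i), s(v k, v l)}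
      {s(v i, v (i - 1)), s(v l, v q), s(v s, v t)} with hK
    have seg : ∀ a b, a ≤ b → b ≤ k → ¬ (a < i ∧ i ≤ b) →
        ¬ (a ≤ l ∧ l + 1 ≤ b ∧ q = l + 1) → ¬ (a ≤ q ∧ q + 1 ≤ b ∧ l = q + 1) →
        ¬ (a ≤ s ∧ s + 1 ≤ b ∧ t = s + 1) → ¬ (a ≤ t ∧ t + 1 ≤ b ∧ s = t + 1) →
        K.Reachable (v a) (v b) := by
      intro a b hab hb c1 c2 c3 c4 c5
      apply pv.seg _ _ hab hb
      rintro u hu hu' (h | h | h)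
      · have := pv.sym (by omega) (by omega) (by omega) (by omega) h
        omega
      · have := pv.sym (by omega) (by omega) (by omega) (by omega) h
        omega
      · have := pv.sym (by omega) (by omega) (by omega) (by omega) h
        omega
    have j1 : K.Reachable (v 0) (v i) := by
      apply Adj.reachable
      rw [hK, mod_adj]
      refine ⟨⟨Or.inr (Or.inl rfl), ?_⟩, hgi.ne⟩
      rintro (h | h | h)
      · have := pv.sym (by omega) (by omega) (by omega) (by omega) h
        omega
      · have := pv.sym (by omega) (by omega) (by omega) (by omega) h
        omega
      · have := pv.sym (by omega) (by omega) (by omega) (by omega) h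
        omega
    have j2 : K.Reachable (v l) (v k) := by
      apply Adj.reachable
      rw [hK, mod_adj]
      refine ⟨⟨Or.inr (Or.inr Sym2.eq_swap), ?_⟩, hgl.ne.symm⟩
      rintro (h | h | h)
      · have := pv.sym (by omega) (by omega) (by omega) (by omega) h
        omega
      · have := pv.sym (by omega) (by omega) (by omega) (by omega) h
        omega
      · have := pv.sym (by omega) (by omega) (by omega) (by omega) h
        omega
    rcases hst with hh | hh | hh | hh | hh
    · -- i < l, t < i
      exact (seg t (i - 1) (by omega) (by omega) (by omega) (by omega) (by omega) (by omega)
        (by omega)).symm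
    · exact (seg 0 (i - 1) (by omega) (by omega) (by omega) (by omega) (by omega) (by omega)
        (by omega)).symm.trans (j1.trans
        (seg i t (by omega) (by omega) (by omega) (by omega) (by omega) (by omega) (by omega)))
    · exact (seg 0 (i - 1) (by omega) (by omega) (by omega) (by omega) (by omega) (by omega)
        (by omega)).symm.trans (j1.trans
        ((seg i l (by omega) (by omega) (by omega) (by omega) (by omega) (by omega)
        (by omega)).trans (j2.trans
        (seg t k (by omega) (by omega) (by omega) (by omega) (by omega) (by omega)
        (by omega)).symm)))
    · exact (seg l (i - 1) (by omega) (by omega) (by omega) (by omega) (by omega) (by omega)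
        (by omega)).symm.trans (j2.trans
        ((seg i k (by omega) (by omega) (by omega) (by omega) (by omega) (by omega)
        (by omega)).symm.trans (j1.symm.trans
        (seg 0 t (by omega) (by omega) (by omega) (by omega) (by omega) (by omega)
        (by omega)))))
    · by_cases hti' : t < i
      · exact (seg t (i - 1) (by omega) (by omega) (by omega) (by omega) (by omega) (by omega)
          (by omega)).symm
      · exact (seg l (i - 1) (by omega) (by omega) (by omega) (by omega) (by omega) (by omega)
          (by omega)).symm.trans (j2.trans
          (seg t k (by omega) (by omega) (by omega) (by omega) (by omega) (by omega)
          (by omega)).symm)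

lemma pigeon {S : Finset ℕ} {n L M : ℕ} (hS : ∀ i ∈ S, i < n)
    (h : (n / L + 1) * M ≤ S.card) :
    ∃ q, M ≤ (S.filter (fun i => i / L = q)).card := by
  obtain ⟨q, -, hq⟩ := Finset.exists_le_card_fiber_of_mul_le_card_of_maps_to
    (s := S) (t := Finset.range (n / L + 1)) (f := fun i => i / L) (n := M)
    (fun i hi => by
      rw [Finset.mem_range]
      have := Nat.div_le_div_right (c := L) (hS i hi).le
      omega)
    ⟨0, by simp⟩ (by rwa [Finset.card_range])
  exact ⟨q, hq⟩

lemma block {S : Finset ℕ} {n L M : ℕ} (hL : 0 < L) (hS : ∀ i ∈ S, i < n)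
    (h : (n / L + 1) * M ≤ S.card) :
    ∃ a, ∃ I ⊆ S, M ≤ I.card ∧ ∀ i ∈ I, a ≤ i ∧ i < a + L := by
  obtain ⟨q, hq⟩ := pigeon hS h
  refine ⟨L * q, _, Finset.filter_subset _ _, hq, fun i hi => ?_⟩
  have h1 := (Finset.mem_filter.1 hi).2
  have h2 := Nat.div_add_mod i L
  have h3 := Nat.mod_lt i hL
  rw [h1] at h2
  omega

lemma median {N : Finset ℕ} {h : ℕ} (hN : 2 * h ≤ N.card) :
    ∃ m, h ≤ (N.filter (· < m)).card ∧ h ≤ (N.filter (fun i => ¬ i < m)).card := by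
  have hex : ∃ m, h ≤ (N.filter (· < m)).card := by
    refine ⟨N.sup id + 1, ?_⟩
    rw [Finset.filter_true_of_mem]
    · omega
    · intro i hi
      have := Finset.le_sup (f := id) hi
      simp only [id] at this
      omega
  classical
  refine ⟨Nat.find hex, Nat.find_spec hex, ?_⟩
  have hle : (N.filter (· < Nat.find hex)).card ≤ h := by
    rcases hm : Nat.find hex with _ | m
    · simp
    · have h1 := Nat.find_min hex (m := m) (by omega)
      have h2 : N.filter (· < m + 1) ⊆ insert m (N.filter (· < m)) := by
        intro i hi
        simp only [Finset.mem_insert, Finset.mem_filter] at *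
        by_cases h3 : i = m
        · exact Or.inl h3
        · exact Or.inr ⟨hi.1, by omega⟩
      have h3 := Finset.card_le_card h2
      have h4 := Finset.card_insert_le m (N.filter (· < m))
      omega
  have := Finset.card_filter_add_card_filter_not (s := N) (fun i => i < Nat.find hex)
  omega

lemma two_blocks {N N' : Finset ℕ} {n L M h : ℕ} (hL : 0 < L) (hN : ∀ i ∈ N, i < n)
    (hN' : ∀ i ∈ N', i < n) (h1 : 2 * h ≤ N.card) (h2 : 2 * h ≤ N'.card)
    (hM : (n / L + 1) * M ≤ h) :
    ∃ a a', ∃ I ⊆ N, ∃ J ⊆ N', M ≤ I.card ∧ M ≤ J.card ∧ (∀ i ∈ I, a ≤ i ∧ i < a + L) ∧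
      (∀ l ∈ J, a' ≤ l ∧ l < a' + L) ∧
      ((∀ i ∈ I, ∀ l ∈ J, i < l) ∨ (∀ i ∈ I, ∀ l ∈ J, l < i)) := by
  obtain ⟨m, hm1, hm2⟩ := median h1
  have hsum := Finset.card_filter_add_card_filter_not (s := N') (fun i => i < m)
  by_cases hc : h ≤ (N'.filter (fun i => ¬ i < m)).card
  · obtain ⟨a, I, hI, hIc, hIa⟩ := block (S := N.filter (· < m)) (n := n) hL
      (fun i hi => hN i (Finset.mem_filter.1 hi).1) (hM.trans hm1)
    obtain ⟨a', J, hJ, hJc, hJa⟩ := block (S := N'.filter (fun i => ¬ i < m)) (n := n) hL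
      (fun i hi => hN' i (Finset.mem_filter.1 hi).1) (hM.trans hc)
    refine ⟨a, a', I, hI.trans (Finset.filter_subset _ _), J,
      hJ.trans (Finset.filter_subset _ _), hIc, hJc, hIa, hJa, Or.inl fun i hi l hl => ?_⟩
    have := (Finset.mem_filter.1 (hI hi)).2
    have := (Finset.mem_filter.1 (hJ hl)).2
    omega
  · obtain ⟨a, I, hI, hIc, hIa⟩ := block (S := N.filter (fun i => ¬ i < m)) (n := n) hL
      (fun i hi => hN i (Finset.mem_filter.1 hi).1) (hM.trans hm2)
    obtain ⟨a', J, hJ, hJc, hJa⟩ := block (S := N'.filter (· < m)) (n := n) hL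
      (fun i hi => hN' i (Finset.mem_filter.1 hi).1) (hM.trans (by omega))
    refine ⟨a, a', I, hI.trans (Finset.filter_subset _ _), J,
      hJ.trans (Finset.filter_subset _ _), hIc, hJc, hIa, hJa, Or.inr fun i hi l hl => ?_⟩
    have := (Finset.mem_filter.1 (hI hi)).2
    have := (Finset.mem_filter.1 (hJ hl)).2
    omega

lemma find_t {X Y B : Finset ℕ} {k : ℕ} {σ : ℕ → ℕ} (hX : X ⊆ Finset.range (k + 1))
    (hm : ∀ t ∈ Y, t ∉ B → σ t ≤ k)
    (hinj : ∀ t ∈ Y, t ∉ B → ∀ u ∈ Y, u ∉ B → σ t = σ u → t = u)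
    (hc : k + 1 + B.card < X.card + Y.card) : ∃ t ∈ Y, t ∉ B ∧ σ t ∈ X := by
  classical
  by_contra hcon
  push Not at hcon
  have h1 : ((Y \ B).image σ).card = (Y \ B).card := by
    apply Finset.card_image_of_injOn
    intro t ht u hu h
    simp only [Finset.coe_sdiff, Set.mem_sdiff, Finset.mem_coe] at ht hu
    exact hinj t ht.1 ht.2 u hu.1 hu.2 h
  have h2 : Disjoint X ((Y \ B).image σ) := by
    rw [Finset.disjoint_right]
    intro s hs
    obtain ⟨t, ht, rfl⟩ := Finset.mem_image.1 hs
    rw [Finset.mem_sdiff] at ht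
    exact hcon t ht.1 ht.2
  have h3 : X ∪ (Y \ B).image σ ⊆ Finset.range (k + 1) := by
    apply Finset.union_subset hX
    intro s hs
    obtain ⟨t, ht, rfl⟩ := Finset.mem_image.1 hs
    rw [Finset.mem_sdiff] at ht
    have := hm t ht.1 ht.2
    simp; omega
  have h4 := Finset.card_le_card h3
  rw [Finset.card_union_of_disjoint h2, Finset.card_range, h1] at h4
  have h5 := Finset.le_card_sdiff B Y
  omega

lemma bad_card (k a a' L : ℕ) :
    (({0, k} : Finset ℕ) ∪ Finset.Ico (a - 4) (a + L + 4) ∪ Finset.Ico (a' - 4) (a' + L + 4)).card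
      ≤ 2 * L + 18 := by
  have h1 := Finset.card_union_le (({0, k} : Finset ℕ) ∪ Finset.Ico (a - 4) (a + L + 4))
    (Finset.Ico (a' - 4) (a' + L + 4))
  have h2 := Finset.card_union_le ({0, k} : Finset ℕ) (Finset.Ico (a - 4) (a + L + 4))
  have h3 : ({0, k} : Finset ℕ).card ≤ 2 := Finset.card_le_two
  rw [Nat.card_Ico] at h1 h2
  omega

lemma nbhd {n : ℕ} {δ : ℝ} {F : SimpleGraph (Fin n)}
    (hF : ∀ A B : Set (Fin n), δ ^ 2 * (n : ℝ) ≤ (A.ncard : ℝ) →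
          (1 / 2 - δ) * (n : ℝ) ≤ (B.ncard : ℝ) → 1 ≤ eBetween F A B)
    {A : Set (Fin n)} (hA : δ ^ 2 * (n : ℝ) ≤ (A.ncard : ℝ)) :
    (1 / 2 + δ) * (n : ℝ) < ({w | ∃ a ∈ A, F.Adj a w}.ncard : ℝ) := by
  set W := {w | ∃ a ∈ A, F.Adj a w} with hW
  by_contra hcon
  push Not at hcon
  have h1 := Set.ncard_add_ncard_compl W
  rw [Nat.card_eq_fintype_card, Fintype.card_fin] at h1
  have h2 : (W.ncard : ℝ) + (Wᶜ.ncard : ℝ) = n := by exact_mod_cast h1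
  have h3 := hF A Wᶜ hA (by linarith)
  have h4 : eBetween F A Wᶜ = 0 := by
    unfold eBetween
    rw [Set.ncard_eq_zero (Set.toFinite _)]
    ext e
    simp only [Set.mem_ofPred_eq, Set.mem_empty_iff_false, iff_false]
    rintro ⟨he, a, ha, b, hb, rfl⟩
    exact hb ⟨a, ha, he⟩
  omega

lemma idx_card {n : ℕ} {H G : SimpleGraph (Fin n)} {x y : Fin n} {k : ℕ} {v : ℕ → Fin n}
    (pv : PV H x y k v) {d : ℕ} {z : Fin n} (hd : degN G z = d)
    (hz : ∀ w, G.Adj z w → H.Reachable x w) :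
    ∃ N : Finset ℕ, (∀ i ∈ N, 2 ≤ i ∧ i + 2 ≤ k ∧ G.Adj z (v i)) ∧ d ≤ N.card + 4 := by
  classical
  let N := (Finset.range (k + 1)).filter (fun i => 2 ≤ i ∧ i + 2 ≤ k ∧ G.Adj z (v i))
  refine ⟨N, fun i hi => (Finset.mem_filter.1 hi).2, ?_⟩
  have hsub : G.neighborSet z ⊆ ((N ∪ {0, 1, k - 1, k}).image v : Finset (Fin n)) := by
    intro w hw
    obtain ⟨a, ha, rfl⟩ := pv.cover w (hz w hw)
    rw [Finset.mem_coe]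
    apply Finset.mem_image_of_mem
    simp only [N, Finset.mem_union, Finset.mem_filter, Finset.mem_range, Finset.mem_insert,
      Finset.mem_singleton]
    by_cases h : 2 ≤ a ∧ a + 2 ≤ k
    · exact Or.inl ⟨by omega, h.1, h.2, hw⟩
    · right; omega
  have h1 := Set.ncard_le_ncard hsub (Set.toFinite _)
  rw [Set.ncard_coe_finset] at h1
  have h2 := h1.trans (Finset.card_image_le.trans (Finset.card_union_le _ _))
  have h3 : ({0, 1, k - 1, k} : Finset ℕ).card ≤ 4 := Finset.card_le_four
  unfold degN at hd
  omega

lemma arith (δ : ℝ) (hδ : 0 < δ) : ∃ n₀ : ℕ, ∀ n : ℕ, n₀ ≤ n → ∀ d : ℕ, d < n →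
    5 * δ * n ≤ d → ∃ L M h : ℕ, 0 < L ∧ 2 * h + 4 ≤ d ∧ (n / L + 1) * M ≤ h ∧ 1 ≤ M ∧
      δ ^ 2 * n ≤ M ∧ (2 * L + 18 : ℝ) ≤ 2 * δ * n := by
  refine ⟨⌈1000 / δ ^ 2⌉₊ + 1, fun n hn d hdn hd => ?_⟩
  have hn1 : 1000 / δ ^ 2 ≤ n := by
    have := Nat.le_ceil (1000 / δ ^ 2)
    have h2 : ((⌈1000 / δ ^ 2⌉₊ : ℕ) : ℝ) ≤ n := by exact_mod_cast (by omega)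
    linarith
  have hn0 : (0 : ℝ) < n := by
    have : 0 < n := by omega
    exact_mod_cast this
  have h1000 : 1000 ≤ δ ^ 2 * n := by
    rw [div_le_iff₀ (by positivity)] at hn1
    linarith
  have hδ5 : δ < 1 / 5 := by
    have : (d : ℝ) < n := by exact_mod_cast hdn
    by_contra hcon
    push Not at hcon
    nlinarith
  have hδn : 1000 ≤ δ * n := by nlinarith [mul_pos hδ hn0]
  set L := ⌊3 * δ * n / 4⌋₊ with hL
  have hL1 : (L : ℝ) ≤ 3 * δ * n / 4 := Nat.floor_le (by positivity)
  have hL2 : 3 * δ * n / 4 < L + 1 := Nat.lt_floor_add_one _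
  have hLpos : 0 < (L : ℝ) := by linarith
  set M := ⌈δ ^ 2 * n⌉₊ with hM
  have hM1 : δ ^ 2 * n ≤ M := Nat.le_ceil _
  have hM2 : (M : ℝ) < δ ^ 2 * n + 1 := Nat.ceil_lt_add_one (by positivity)
  refine ⟨L, M, (n / L + 1) * M, by exact_mod_cast hLpos, ?_, le_refl _, ?_, hM1, by linarith⟩
  · have hq : ((n / L : ℕ) : ℝ) ≤ n / L := Nat.cast_div_le
    have hq2 : (n : ℝ) / L ≤ 3 / 2 / δ := by
      rw [div_le_div_iff₀ hLpos hδ]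
      nlinarith
    have hq3 : ((n / L : ℕ) : ℝ) + 1 ≤ (17 / 10) / δ := by
      have : (1 : ℝ) ≤ (2 / 10) / δ := by rw [le_div_iff₀ hδ]; linarith
      have e : (17 / 10 : ℝ) / δ = 3 / 2 / δ + (2 / 10) / δ := by ring
      linarith
    have hM3 : (M : ℝ) ≤ (11 / 10) * (δ ^ 2 * n) := by linarith
    have : (((n / L : ℕ) : ℝ) + 1) * M ≤ (17 / 10) / δ * ((11 / 10) * (δ ^ 2 * n)) := by
      apply mul_le_mul hq3 hM3 (by positivity) (by positivity)
    have e : (17 / 10) / δ * ((11 / 10) * (δ ^ 2 * n)) = 187 / 100 * (δ * n) := by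
      field_simp
      ring
    rw [e] at this
    have hfin : (2 * ((((n / L : ℕ) : ℝ) + 1) * M) + 4 : ℝ) ≤ d := by linarith
    exact_mod_cast hfin
  · have : (1 : ℝ) ≤ M := by linarith
    exact_mod_cast this

lemma PV.card_le {n : ℕ} {H : SimpleGraph (Fin n)} {x y : Fin n} {k : ℕ} {v : ℕ → Fin n}
    (pv : PV H x y k v) : k + 1 ≤ n := by
  classical
  have h1 : ((Finset.range (k + 1)).image v).card = (Finset.range (k + 1)).card := by
    apply Finset.card_image_of_injOn
    intro a ha b hb h
    simp only [Finset.coe_range, Set.mem_Iio] at ha hb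
    exact pv.inj a (by omega) b (by omega) h
  have h2 := Finset.card_le_univ ((Finset.range (k + 1)).image v)
  rw [h1, Finset.card_range, Fintype.card_fin] at h2
  exact h2

lemma PV.reach {V : Type*} {H : SimpleGraph V} {x y : V} {k : ℕ} {v : ℕ → V}
    (pv : PV H x y k v) {a : ℕ} (ha : a ≤ k) : H.Reachable (v 0) (v a) := by
  induction a with
  | zero => exact .refl _
  | succ a ih => exact (ih (by omega)).trans (pv.adj a (by omega)).reachable

/-- Neighbourhood of the set of new endpoints, in terms of indices. -/
lemma idx_nbhd {n : ℕ} {δ : ℝ} {F H : SimpleGraph (Fin n)}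
    (hF : ∀ A B : Set (Fin n), δ ^ 2 * (n : ℝ) ≤ (A.ncard : ℝ) →
          (1 / 2 - δ) * (n : ℝ) ≤ (B.ncard : ℝ) → 1 ≤ eBetween F A B)
    {x y : Fin n} {k : ℕ} {v : ℕ → Fin n} (pv : PV H x y k v) {I : Finset ℕ} {g : ℕ → ℕ} {M : ℕ}
    (hM : δ ^ 2 * (n : ℝ) ≤ M) (hI : M ≤ I.card) (hg : ∀ i ∈ I, g i ≤ k)
    (hgi : ∀ i ∈ I, ∀ j ∈ I, g i = g j → i = j)
    (hr : ∀ i ∈ I, ∀ w, F.Adj (v (g i)) w → H.Reachable x w) :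
    ∃ X ⊆ Finset.range (k + 1), (∀ t ∈ X, ∃ i ∈ I, F.Adj (v (g i)) (v t)) ∧
      (1 / 2 + δ) * (n : ℝ) < X.card := by
  classical
  let X := (Finset.range (k + 1)).filter (fun t => ∃ i ∈ I, F.Adj (v (g i)) (v t))
  refine ⟨X, Finset.filter_subset _ _, fun t ht => (Finset.mem_filter.1 ht).2, ?_⟩
  have hA : (((I.image (fun i => v (g i)) : Finset (Fin n)) : Set (Fin n)).ncard : ℝ) = I.card := by
    rw [Set.ncard_coe_finset, Finset.card_image_of_injOn]
    intro i hi j hj h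
    exact hgi i hi j hj (pv.inj _ (hg i hi) _ (hg j hj) h)
  have hMI : (M : ℝ) ≤ I.card := by exact_mod_cast hI
  have h1 := nbhd hF (A := ((I.image (fun i => v (g i)) : Finset (Fin n)) : Set (Fin n)))
    (by rw [hA]; linarith)
  refine h1.trans_le ?_
  have h2 : {w | ∃ a ∈ ((I.image (fun i => v (g i)) : Finset (Fin n)) : Set (Fin n)), F.Adj a w} ⊆
      ((X.image v : Finset (Fin n)) : Set (Fin n)) := by
    rintro w ⟨a, ha, haw⟩
    rw [Finset.mem_coe, Finset.mem_image] at ha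
    obtain ⟨i, hi, rfl⟩ := ha
    obtain ⟨t, ht, rfl⟩ := pv.cover w (hr i hi w haw)
    rw [Finset.mem_coe]
    apply Finset.mem_image_of_mem
    exact Finset.mem_filter.2 ⟨Finset.mem_range.2 (by omega), i, hi, haw⟩
  have h3 := Set.ncard_le_ncard h2 (Set.toFinite _)
  rw [Set.ncard_coe_finset] at h3
  exact_mod_cast h3.trans Finset.card_image_le

lemma core {n : ℕ} {δ : ℝ} {G F H : SimpleGraph (Fin n)} (hGF : Disjoint G F) (hH : H ≤ G ⊔ F)
    (hF : ∀ A B : Set (Fin n), δ ^ 2 * (n : ℝ) ≤ (A.ncard : ℝ) →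
          (1 / 2 - δ) * (n : ℝ) ≤ (B.ncard : ℝ) → 1 ≤ eBetween F A B)
    {k : ℕ} {v : ℕ → Fin n} (pv : PV H (v 0) (v k) k v) (st : St H (v 0) (v k))
    {I J : Finset ℕ} {L M a a' : ℕ} (hM1 : 1 ≤ M) (hM : δ ^ 2 * (n : ℝ) ≤ M)
    (hL : (2 * L + 18 : ℝ) ≤ 2 * δ * n)
    (hI : ∀ i ∈ I, 2 ≤ i ∧ i + 2 ≤ k ∧ G.Adj (v 0) (v i))
    (hJ : ∀ i ∈ J, 2 ≤ i ∧ i + 2 ≤ k ∧ G.Adj (v k) (v i))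
    (hIM : M ≤ I.card) (hJM : M ≤ J.card)
    (hIa : ∀ i ∈ I, a ≤ i ∧ i < a + L) (hJa : ∀ l ∈ J, a' ≤ l ∧ l < a' + L)
    (qf σ : ℕ → ℕ)
    (hq : (∀ l, qf l = l + 1) ∨ (∀ l, qf l = l - 1))
    (hc : ∀ i ∈ I, ∀ l ∈ J, (i < l ∧ qf l = l + 1) ∨ (l < i ∧ qf l + 1 = l))
    (hσ : ∀ t, σ t = t + 1 ∨ σ t = t - 1)
    (hinj : ∀ t u, 0 < t → 0 < u → (t + 4 < a ∨ a + L + 4 ≤ t) → (t + 4 < a' ∨ a' + L + 4 ≤ t) →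
      (u + 4 < a ∨ a + L + 4 ≤ u) → (u + 4 < a' ∨ a' + L + 4 ≤ u) → σ t = σ u → t = u)
    (hst : ∀ i ∈ I, ∀ l ∈ J, ∀ t, 0 < t → (t + 4 < a ∨ a + L + 4 ≤ t) →
      (t + 4 < a' ∨ a' + L + 4 ≤ t) →
      (i < l ∧ t < i ∧ σ t + 1 = t) ∨ (i < l ∧ i < t ∧ t < l ∧ σ t = t + 1) ∨
      (i < l ∧ l < t ∧ σ t + 1 = t) ∨ (l < i ∧ t < l ∧ σ t = t + 1) ∨
      (l < i ∧ l < t ∧ σ t + 1 = t)) :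
    C1 G F H ∨ C2 G F H := by
  classical
  obtain ⟨i₀, hi₀⟩ : I.Nonempty := Finset.card_pos.1 (by omega)
  obtain ⟨l₀, hl₀⟩ : J.Nonempty := Finset.card_pos.1 (by omega)
  have hqk : ∀ l ∈ J, qf l ≤ k := by
    intro l hl
    have := hJ l hl
    rcases hq with h | h <;> rw [h] <;> omega
  have hmem : ∀ w, ¬ H.Reachable (v 0) w → ∀ p ≤ k, ∀ q ≤ k, w ∉ s(v p, v q) := by
    intro w hw p hp q hq' hm
    rw [Sym2.mem_iff] at hm
    rcases hm with rfl | rfl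
    · exact hw (pv.reach hp)
    · exact hw (pv.reach hq')
  by_cases hrx : ∀ i ∈ I, ∀ w, F.Adj (v (i - 1)) w → H.Reachable (v 0) w
  swap
  · left
    push Not at hrx
    obtain ⟨i, hi, w, hw, hnw⟩ := hrx
    obtain ⟨a1, a2, a3⟩ := hI i hi
    obtain ⟨b1, b2, b3⟩ := hJ l₀ hl₀
    exact ext_final (rot2 (F := F) pv st a1 a2 b1 b2 (hc i hi l₀ hl₀) a3 b3)
      (fun h => hnw ((pv.reach (by omega)).trans h)) (Or.inr hw)
      (hmem w hnw _ (by omega) _ (by omega)) (hmem w hnw _ (by omega) _ (by omega))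
  by_cases hry : ∀ l ∈ J, ∀ w, F.Adj (v (qf l)) w → H.Reachable (v 0) w
  swap
  · left
    push Not at hry
    obtain ⟨l, hl, w, hw, hnw⟩ := hry
    obtain ⟨a1, a2, a3⟩ := hI i₀ hi₀
    obtain ⟨b1, b2, b3⟩ := hJ l hl
    exact ext_final (rot2 (F := F) pv st a1 a2 b1 b2 (hc i₀ hi₀ l hl) a3 b3).symm
      (fun h => hnw ((pv.reach (hqk l hl)).trans h)) (Or.inr hw)
      (hmem w hnw _ (by omega) _ (by omega)) (hmem w hnw _ (by omega) _ (by omega))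
  right
  obtain ⟨X, hXk, hX, hXc⟩ := idx_nbhd hF pv (g := fun i => i - 1) hM hIM
    (fun i hi => by have := hI i hi; omega)
    (fun i hi j hj h => by have := hI i hi; have := hI j hj; omega) hrx
  obtain ⟨Y, hYk, hY, hYc⟩ := idx_nbhd hF pv (g := qf) hM hJM hqk
    (fun i hi j hj h => by
      have := hJ i hi
      have := hJ j hj
      rcases hq with hq | hq <;> rw [hq, hq] at h <;> omega) hry
  have hB := bad_card k a a' L
  set B := ({0, k} : Finset ℕ) ∪ Finset.Ico (a - 4) (a + L + 4) ∪
    Finset.Ico (a' - 4) (a' + L + 4) with hBdef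
  have hk := pv.card_le
  have hnB : ∀ t ∈ Y, t ∉ B → 0 < t ∧ t < k ∧ (t + 4 < a ∨ a + L + 4 ≤ t) ∧
      (t + 4 < a' ∨ a' + L + 4 ≤ t) := by
    intro t ht htB
    have := Finset.mem_range.1 (hYk ht)
    simp only [hBdef, Finset.mem_union, Finset.mem_insert, Finset.mem_singleton, Finset.mem_Ico,
      not_or, not_and] at htB
    omega
  have hcount : k + 1 + B.card < X.card + Y.card := by
    have h1 : (B.card : ℝ) ≤ 2 * L + 18 := by exact_mod_cast hB
    have h2 : ((k : ℝ) + 1) ≤ n := by exact_mod_cast hk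
    have h3 : ((k : ℝ) + 1 + B.card) < X.card + Y.card := by linarith
    exact_mod_cast h3
  obtain ⟨t, htY, htB, htX⟩ := find_t (σ := σ) hXk
    (fun t ht htB => by
      have := hnB t ht htB
      rcases hσ t with h | h <;> rw [h] <;> omega)
    (fun t ht htB u hu huB h => by
      obtain ⟨t1, t2, t3, t4⟩ := hnB t ht htB
      obtain ⟨u1, u2, u3, u4⟩ := hnB u hu huB
      exact hinj t u t1 u1 t3 t4 u3 u4 h) hcount
  obtain ⟨t1, t2, t3, t4⟩ := hnB t htY htB
  obtain ⟨i, hi, his⟩ := hX _ htX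
  obtain ⟨l, hl, hlt⟩ := hY _ htY
  obtain ⟨a1, a2, a3⟩ := hI i hi
  obtain ⟨b1, b2, b3⟩ := hJ l hl
  have hia := hIa i hi
  have hla := hJa l hl
  exact end_game hGF hH pv st a1 a2 b1 b2 (hc i hi l hl) a3 b3
    (by rcases hσ t with h | h <;> rw [h] <;> omega) (by omega) (by omega) (by omega)
    (hst i hi l hl t t1 t3 t4) his hlt

lemma step_main {n : ℕ} {δ : ℝ} {G F H : SimpleGraph (Fin n)} (hGF : Disjoint G F)
    (hH : H ≤ G ⊔ F)
    (hF : ∀ A B : Set (Fin n), δ ^ 2 * (n : ℝ) ≤ (A.ncard : ℝ) →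
          (1 / 2 - δ) * (n : ℝ) ≤ (B.ncard : ℝ) → 1 ≤ eBetween F A B)
    {d : ℕ} (hreg : IsRegN G d) (hP : IsPartialHC H) {L M h : ℕ} (hL0 : 0 < L)
    (hd : 2 * h + 4 ≤ d) (hnL : (n / L + 1) * M ≤ h) (hM1 : 1 ≤ M)
    (hM : δ ^ 2 * (n : ℝ) ≤ M) (hL : (2 * L + 18 : ℝ) ≤ 2 * δ * n) :
    C1 G F H ∨ C2 G F H := by
  obtain ⟨x, y, st⟩ := exists_St hP
  by_cases hx : ∀ w, G.Adj x w → H.Reachable x w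
  swap
  · push Not at hx
    obtain ⟨w, hw, hnw⟩ := hx
    exact Or.inl (ext_base st hnw (Or.inl hw))
  by_cases hy : ∀ w, G.Adj y w → H.Reachable x w
  swap
  · push Not at hy
    obtain ⟨w, hw, hnw⟩ := hy
    exact Or.inl (ext_base st.symm (fun h => hnw (st.reach.trans h)) (Or.inl hw))
  have hxy : x ≠ y := by
    rintro rfl
    have h1 := st.deg x (.refl _)
    rw [ind_self] at h1
    have h0 : degN H x = 0 := by omega
    have h2 : (G.neighborSet x).Nonempty := by
      apply Set.nonempty_of_ncard_ne_zero
      have := hreg x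
      unfold degN at this
      omega
    obtain ⟨w, hw⟩ := h2
    obtain ⟨p⟩ := hx w hw
    have hne : x ≠ w := SimpleGraph.Adj.ne hw
    cases p with
    | nil => exact hne rfl
    | cons hadj _ =>
      unfold degN at h0
      rw [Set.ncard_eq_zero (Set.toFinite _)] at h0
      have : _ ∈ H.neighborSet x := hadj
      rw [h0] at this
      exact this
  obtain ⟨k, v, pv⟩ := exists_PV hxy st.reach
    (fun v hv => by have := st.deg v hv; omega)
    (by have := st.deg x (.refl _); rw [ind_self] at this; omega)
    (by have := st.deg y st.reach; rw [ind_self] at this; omega)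
  obtain rfl := pv.h0
  obtain rfl := pv.hk
  obtain ⟨N, hN, hNc⟩ := idx_card pv (hreg (v 0)) hx
  obtain ⟨N', hN', hNc'⟩ := idx_card pv (hreg (v k)) hy
  have hk := pv.card_le
  obtain ⟨a, a', I, hI, J, hJ, hIM, hJM, hIa, hJa, hlt⟩ := two_blocks (n := n) hL0
    (fun i hi => by have := hN i hi; omega) (fun i hi => by have := hN' i hi; omega)
    (h := h) (by omega) (by omega) hnL
  rcases hlt with hlt | hlt
  · refine core hGF hH hF pv st hM1 hM hL (fun i hi => hN i (hI hi)) (fun i hi => hN' i (hJ hi))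
      hIM hJM hIa hJa (fun l => l + 1) (fun t => if t < a then t - 1 else if t < a' then t + 1
        else t - 1) (Or.inl fun _ => rfl) (fun i hi l hl => Or.inl ⟨hlt i hi l hl, rfl⟩) ?_ ?_ ?_
    · intro t; split_ifs <;> simp
    · intro t u ht hu h1 h2 h3 h4 h5
      split_ifs at h5 <;> omega
    · intro i hi l hl t ht h1 h2
      have := hIa i hi
      have := hJa l hl
      have := hlt i hi l hl
      split_ifs <;> omega
  · refine core hGF hH hF pv st hM1 hM hL (fun i hi => hN i (hI hi)) (fun i hi => hN' i (hJ hi))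
      hIM hJM hIa hJa (fun l => l - 1) (fun t => if t < a' then t + 1
        else t - 1) (Or.inr fun _ => rfl) (fun i hi l hl => Or.inr ⟨hlt i hi l hl, ?_⟩) ?_ ?_ ?_
    · have := hN' l (hJ hl)
      omega
    · intro t; split_ifs <;> simp
    · intro t u ht hu h1 h2 h3 h4 h5
      split_ifs at h5 <;> omega
    · intro i hi l hl t ht h1 h2
      have := hIa i hi
      have := hJa l hl
      have := hlt i hi l hl
      split_ifs <;> omega

/-- Claim 2.4 of the paper. Let `G`, `F` be edge-disjoint graphs on
`[n]` with `G` `d`-regular, `d ≥ ε c n`, and `F` having an edge between any two large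
sets. If `H` is a partial HC in `G ∪ F`, then either (1) `H` can be turned into a
partial HC with one fewer component (and at least as many edges) by one of the four
exchanges, or (2) `H` can be turned into a `(≤2)`-factor with the same number of
components and one more edge. -/
theorem rotation_extension_step (c ε δ : ℝ) (hc : 0 < c) (hε : 0 < ε)
    (hδ₀ : 0 < δ) (hδ₁ : δ ≤ ε * c / 5) :
    ∃ n₀ : ℕ, ∀ n : ℕ, n₀ ≤ n →
      ∀ (G F : SimpleGraph (Fin n)) (d : ℕ),
        Disjoint G F → IsRegN G d → ε * (c * (n : ℝ)) ≤ (d : ℝ) →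
        (∀ A B : Set (Fin n), δ ^ 2 * (n : ℝ) ≤ (A.ncard : ℝ) →
          (1 / 2 - δ) * (n : ℝ) ≤ (B.ncard : ℝ) → 1 ≤ eBetween F A B) →
        ∀ H : SimpleGraph (Fin n), H ≤ G ⊔ F → IsPartialHC H →
        ((∃ e ∈ (G ⊔ F).edgeSet \ H.edgeSet, ∃ e₁ ∈ (G ⊔ F).edgeSet \ H.edgeSet,
            ∃ e₂ ∈ (G ⊔ F).edgeSet \ H.edgeSet, ∃ e' ∈ H.edgeSet, ∃ e₁' ∈ H.edgeSet,
            ∃ e₂' ∈ H.edgeSet,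
              GoodStep H (modifyGraph H {e} {e'}) ∨
              GoodStep H (modifyGraph H {e} ∅) ∨
              GoodStep H (modifyGraph H {e, e₁, e₂} {e', e₁', e₂'}) ∨
              GoodStep H (modifyGraph H {e, e₁, e₂} {e₁', e₂'})) ∨
          (∃ e₁ ∈ (G ⊔ F).edgeSet \ H.edgeSet, ∃ e₂ ∈ (G ⊔ F).edgeSet \ H.edgeSet,
            ∃ e₃ ∈ (G ⊔ F).edgeSet \ H.edgeSet, ∃ e₁' ∈ H.edgeSet, ∃ e₂' ∈ H.edgeSet,
            ∃ e₃' ∈ H.edgeSet, ∃ f ∈ F.edgeSet \ H.edgeSet,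
              IsLe2Factor (modifyGraph H {e₁, e₂, e₃, f} {e₁', e₂', e₃'}) ∧
              modifyGraph H {e₁, e₂, e₃, f} {e₁', e₂', e₃'} ≤ G ⊔ F ∧
              numComp (modifyGraph H {e₁, e₂, e₃, f} {e₁', e₂', e₃'}) = numComp H ∧
              (modifyGraph H {e₁, e₂, e₃, f} {e₁', e₂', e₃'}).edgeSet.ncard =
                H.edgeSet.ncard + 1)) := by
  obtain ⟨n₀, hn₀⟩ := arith δ hδ₀
  refine ⟨n₀ + 1, fun n hn G F d hGF hreg hd hF H hH hP => ?_⟩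
  have hdn : d < n := by
    have h1 := hreg ⟨0, by omega⟩
    have h2 : G.neighborSet ⟨0, by omega⟩ ⊂ Set.univ := by
      rw [Set.ssubset_univ_iff]
      intro h
      have : (⟨0, by omega⟩ : Fin n) ∈ G.neighborSet ⟨0, by omega⟩ := by rw [h]; trivial
      exact G.irrefl this
    have h3 := Set.ncard_lt_ncard h2 (Set.toFinite _)
    rw [Set.ncard_univ, Nat.card_eq_fintype_card, Fintype.card_fin] at h3
    unfold degN at h1
    omega
  have hd5 : 5 * δ * n ≤ d := by
    have : (0 : ℝ) ≤ n := Nat.cast_nonneg n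
    nlinarith
  obtain ⟨L, M, h, hL0, h1, h2, h3, h4, h5⟩ := hn₀ n (by omega) d hdn hd5
  exact step_main hGF hH hF hreg hP hL0 h1 h2 h3 h4 h5
end
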